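/- arXiv:2312.06846 — 3 statements merged into one kernel-verified Lean document; each statement's English description precedes it below -/
import Mathlib

section
/- Let (R,m) be a Cohen-Macaulay Noetherian local ring of dimension d > 0 with infinite residue field, let I be an m-primary ideal, and let J be a minimal reduction of I. Then for every n ≥ 0, λ(R/I^{n+1}) = e_0(I)·C(n+d,d) + (λ(R/I) − e_0(I))·C(n+d−1,d−1) − λ(I^{n+1}/I·J^n), where C denotes the binomial coefficient. -/
open Finset IsLocalRing

/-- The length of an `R`-module `M`: the Krull dimension of its lattice of submodules,
i.e. the supremum of the lengths of chains of submodules of `M`. -/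
noncomputable def moduleLength (R M : Type*) [CommRing R] [AddCommGroup M] [Module R M] :
    WithBot ℕ∞ :=
  Order.krullDim (Submodule R M)

/-- A local Noetherian ring is Cohen-Macaulay if its depth equals its Krull dimension,
equivalently, if it admits a regular sequence in the maximal ideal whose length is the
Krull dimension. -/
def IsCohenMacaulayLocalRing (R : Type*) [CommRing R] [IsLocalRing R] : Prop :=
  ∃ rs : List R, (∀ x ∈ rs, x ∈ maximalIdeal R) ∧
    RingTheory.Sequence.IsRegular R rs ∧ (rs.length : WithBot ℕ∞) = ringKrullDim R

/-- `e 0, …, e d` are the Hilbert coefficients of an ideal `I` in a ring of dimension `d`: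
for all large `n`, `λ(R ⧸ I^(n+1)) = ∑_{i=0}^{d} (-1)^i (e i) C(n+d-i, d-i)`. -/
def HasHilbertCoeffs {R : Type*} [CommRing R] (I : Ideal R) (d : ℕ) (e : ℕ → ℤ) : Prop :=
  ∃ N : ℕ, ∀ n ≥ N, ∃ l : ℕ,
    moduleLength R (R ⧸ I ^ (n + 1)) = (l : WithBot ℕ∞) ∧
    (l : ℤ) = ∑ i ∈ Finset.range (d + 1), (-1 : ℤ) ^ i * e i * ((n + d - i).choose (d - i))

/-- `J` is a reduction of `I`. -/
def IsReduction {R : Type*} [CommRing R] (J I : Ideal R) : Prop :=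
  J ≤ I ∧ ∃ r : ℕ, I ^ (r + 1) = J * I ^ r

/-- `J` is a minimal reduction of `I`. -/
def IsMinimalReduction {R : Type*} [CommRing R] (J I : Ideal R) : Prop :=
  IsReduction J I ∧ ∀ J' : Ideal R, J' ≤ J → IsReduction J' I → J' = J

section RegularModulo

variable {R : Type*} [CommRing R]

/-- `w` is a nonzerodivisor on `R ⧸ A`. -/
def IsRegularModulo (w : R) (A : Ideal R) : Prop :=
  ∀ r, w * r ∈ A → r ∈ A

/-- The ideal is generated by a weakly regular sequence of the given length. -/
inductive IsRegularlyGenerated : Ideal R → ℕ → Prop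
  | bot : IsRegularlyGenerated ⊥ 0
  | sup {J : Ideal R} {n : ℕ} {x : R} : IsRegularlyGenerated J n → IsRegularModulo x J →
      IsRegularlyGenerated (J ⊔ Ideal.span {x}) (n + 1)

/-- `J` contains a weakly regular sequence on `R ⧸ A` of length `n`. -/
def HasRegularSequence (J : Ideal R) : ℕ → Ideal R → Prop
  | 0, _ => True
  | n + 1, A => ∃ z ∈ J, IsRegularModulo z A ∧ HasRegularSequence J n (A ⊔ Ideal.span {z})

theorem IsRegularModulo.pow {w : R} {A : Ideal R} (h : IsRegularModulo w A) (n : ℕ) :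
    IsRegularModulo (w ^ n) A := by
  induction n with
  | zero => intro r hr; simpa using hr
  | succ n ih => exact fun r hr => ih r (h _ (by rwa [← mul_assoc, ← pow_succ']))

theorem mem_sup_span_singleton {A : Ideal R} {x u : R} :
    u ∈ A ⊔ Ideal.span {x} ↔ ∃ a ∈ A, ∃ b, u = a + x * b := by
  rw [Submodule.mem_sup]
  constructor
  · rintro ⟨a, ha, y, hy, rfl⟩
    obtain ⟨b, rfl⟩ := Ideal.mem_span_singleton'.1 hy
    exact ⟨a, ha, b, by ring⟩
  · rintro ⟨a, ha, b, rfl⟩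
    exact ⟨a, ha, _, Ideal.mul_mem_right _ _ (Ideal.mem_span_singleton_self x), rfl⟩

/-- The second element of a regular sequence `y, w` stays first after exchanging the two. -/
theorem IsRegularModulo.swap_right {A : Ideal R} {y w : R} (hy : IsRegularModulo y A)
    (hw : IsRegularModulo w (A ⊔ Ideal.span {y})) :
    IsRegularModulo y (A ⊔ Ideal.span {w}) := by
  intro u hu
  obtain ⟨a, ha, v, hv⟩ := mem_sup_span_singleton.1 hu
  have hv' : v ∈ A ⊔ Ideal.span {y} :=
    hw _ (mem_sup_span_singleton.2 ⟨-a, A.neg_mem ha, u, by linear_combination -hv⟩)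
  obtain ⟨a', ha', t, rfl⟩ := mem_sup_span_singleton.1 hv'
  have : u - w * t ∈ A := hy _ (by
    rw [show y * (u - w * t) = a + w * a' by linear_combination hv]
    exact A.add_mem ha (A.mul_mem_left _ ha'))
  exact mem_sup_span_singleton.2 ⟨_, this, t, by ring⟩

theorem IsRegularModulo.swap_left [IsNoetherianRing R] [IsLocalRing R] {A : Ideal R} {y w : R}
    (hym : y ∈ maximalIdeal R) (hy : IsRegularModulo y A)
    (hw : IsRegularModulo w (A ⊔ Ideal.span {y})) : IsRegularModulo w A := by
  let N : Ideal R := Submodule.comap (LinearMap.mulLeft R w) A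
  suffices N ≤ A from fun r hr => this hr
  refine Submodule.le_of_le_smul_of_le_jacobson_bot (I := maximalIdeal R)
    (IsNoetherian.noetherian N) (maximalIdeal_le_jacobson _) fun u hu => ?_
  have hu' : w * u ∈ A := hu
  obtain ⟨a, ha, v, rfl⟩ := mem_sup_span_singleton.1 (hw u (Ideal.mem_sup_left hu'))
  have hv : w * v ∈ A := hy _ (by
    rw [show y * (w * v) = w * (a + y * v) - w * a by ring]
    exact A.sub_mem hu' (A.mul_mem_left _ ha))
  exact Submodule.add_mem_sup ha (Submodule.smul_mem_smul hym hv)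

/-- If `J` has positive grade on `R ⧸ A` and `R ⧸ B`, and is not contained in `C`, then it contains
an element outside `C` regular on both quotients. -/
theorem exists_isRegularModulo_not_mem [IsNoetherianRing R] {J A B C : Ideal R}
    (hC : ¬ J ≤ C)
    (hA : ∀ u, (∀ j ∈ J, j * u ∈ A) → u ∈ A) (hB : ∀ u, (∀ j ∈ J, j * u ∈ B) → u ∈ B) :
    ∃ w ∈ J, w ∉ C ∧ IsRegularModulo w A ∧ IsRegularModulo w B := by
  have not_le : ∀ D : Ideal R, (∀ u, (∀ j ∈ J, j * u ∈ D) → u ∈ D) →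
      ∀ p ∈ associatedPrimes R (R ⧸ D), ¬ J ≤ p := by
    intro D hD p hp hJ
    rw [AssociatedPrimes.mem_iff, isAssociatedPrime_iff] at hp
    obtain ⟨hprime, x, rfl⟩ := hp
    obtain ⟨u, rfl⟩ := Ideal.Quotient.mk_surjective x
    have hu : u ∈ D := hD u fun j hj => by
      have := hJ hj
      rw [Submodule.mem_colon_singleton, Submodule.mem_bot] at this
      exact Ideal.Quotient.eq_zero_iff_mem.1 this
    apply hprime.ne_top
    rw [Ideal.eq_top_iff_one, Submodule.mem_colon_singleton, Ideal.Quotient.eq_zero_iff_mem.2 hu,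
      smul_zero]
    exact Submodule.zero_mem _
  have regular : ∀ (D : Ideal R) (w : R), (∀ p ∈ associatedPrimes R (R ⧸ D), w ∉ p) →
      IsRegularModulo w D := by
    intro D w hw r hr
    by_contra hrD
    have : w ∈ ⋃ p ∈ associatedPrimes R (R ⧸ D), (p : Set R) := by
      rw [biUnion_associatedPrimes_eq_zero_divisors]
      exact ⟨Ideal.Quotient.mk D r, fun h => hrD (Ideal.Quotient.eq_zero_iff_mem.1 h),
        Ideal.Quotient.eq_zero_iff_mem.2 hr⟩
    obtain ⟨p, hp, hwp⟩ := Set.mem_iUnion₂.1 this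
    exact hw p hp hwp
  let S : Set (Ideal R) := insert C (associatedPrimes R (R ⧸ A) ∪ associatedPrimes R (R ⧸ B))
  have hS : S.Finite :=
    ((associatedPrimes.finite R (R ⧸ A)).union (associatedPrimes.finite R (R ⧸ B))).insert C
  have key := (Ideal.subset_union_prime_finite hS (f := id) C C (I := J) (by
    rintro p (rfl | hp | hp) h1 _
    · exact absurd rfl h1
    · exact IsAssociatedPrime.isPrime hp
    · exact IsAssociatedPrime.isPrime hp)).not.2 (by
    rintro ⟨p, (rfl | hp | hp), hJ⟩
    · exact hC hJ
    · exact not_le A hA p hp hJ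
    · exact not_le B hB p hp hJ)
  obtain ⟨w, hwJ, hw⟩ := Set.not_subset.1 key
  simp only [Set.mem_iUnion, not_exists] at hw
  exact ⟨w, hwJ, hw C (Or.inl rfl), regular A w fun p hp => hw p (Or.inr (Or.inl hp)),
    regular B w fun p hp => hw p (Or.inr (Or.inr hp))⟩

theorem HasRegularSequence.mem_of_forall_mul_mem {J A : Ideal R} {n : ℕ}
    (h : HasRegularSequence J (n + 1) A) (u : R) (hu : ∀ j ∈ J, j * u ∈ A) : u ∈ A :=
  let ⟨z, hz, hreg, _⟩ := h
  hreg u (hu z hz)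

/-- The grade drops by exactly one modulo any regular element. -/
theorem HasRegularSequence.sup_span_singleton [IsNoetherianRing R] [IsLocalRing R] {J : Ideal R}
    (hJ : J ≤ maximalIdeal R) (hJ0 : J ≠ ⊥) (n : ℕ) : ∀ {A : Ideal R} {z : R},
    HasRegularSequence J (n + 1) A → z ∈ J → IsRegularModulo z A →
    HasRegularSequence J n (A ⊔ Ideal.span {z}) := by
  induction n with
  | zero => intros; trivial
  | succ n ih =>
    rintro A z ⟨y, hyJ, hy, hseq⟩ hzJ hz
    have grade_z : ∀ u, (∀ j ∈ J, j * u ∈ A ⊔ Ideal.span {z}) → u ∈ A ⊔ Ideal.span {z} := by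
      intro u hu
      obtain ⟨a, ha, v, hv⟩ := mem_sup_span_singleton.1 (hu y hyJ)
      have hv' : v ∈ A ⊔ Ideal.span {y} := hseq.mem_of_forall_mul_mem v fun j hj => by
        obtain ⟨b, hb, t, ht⟩ := mem_sup_span_singleton.1 (hu j hj)
        have : j * v - y * t ∈ A := hz _ (by
          rw [show z * (j * v - y * t) = y * b - j * a by linear_combination y * ht - j * hv]
          exact A.sub_mem (A.mul_mem_left _ hb) (A.mul_mem_left _ ha))
        exact mem_sup_span_singleton.2 ⟨_, this, t, by ring⟩
      obtain ⟨a', ha', t, rfl⟩ := mem_sup_span_singleton.1 hv'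
      have : u - z * t ∈ A := hy _ (by
        rw [show y * (u - z * t) = a + z * a' by linear_combination hv]
        exact A.add_mem ha (A.mul_mem_left _ ha'))
      exact mem_sup_span_singleton.2 ⟨_, this, t, by ring⟩
    obtain ⟨w, hwJ, -, hwy, hwz⟩ := exists_isRegularModulo_not_mem (C := ⊥) (fun h => hJ0 (le_bot_iff.1 h)) hseq.mem_of_forall_mul_mem grade_z
    have hw : IsRegularModulo w A := hy.swap_left (hJ hyJ) hwy
    have hyw : IsRegularModulo y (A ⊔ Ideal.span {w}) := hy.swap_right hwy
    have hseqw : HasRegularSequence J (n + 1) (A ⊔ Ideal.span {w}) :=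
      ⟨y, hyJ, hyw, by rw [sup_right_comm]; exact ih hseq hwJ hwy⟩
    refine ⟨w, hwJ, hwz, ?_⟩
    rw [sup_right_comm]
    exact ih hseqw hzJ (hz.swap_right hwz)

/-- A regular sequence in an ideal can be replaced by one in a subideal with the same radical. -/
theorem HasRegularSequence.of_le_radical [IsNoetherianRing R] [IsLocalRing R] {J J' : Ideal R}
    (hJ : J ≤ maximalIdeal R) (hJ0 : J ≠ ⊥) (hJ' : J' ≤ J) (hrad : J ≤ J'.radical) (n : ℕ) :
    ∀ {A : Ideal R}, HasRegularSequence J n A → HasRegularSequence J' n A := by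
  induction n with
  | zero => intros; trivial
  | succ n ih =>
    intro A h
    obtain ⟨z, hzJ, hz, -⟩ := id h
    obtain ⟨k, hk⟩ := hrad hzJ
    exact ⟨z ^ k, hk, hz.pow k, ih (h.sup_span_singleton hJ hJ0 n (hJ' hk) (hz.pow k))⟩

/-- If `J` has grade at least `k` on `R ⧸ A` and is generated modulo `A` by `k` elements,
it is generated modulo `A` by a regular sequence of length `k`. -/
theorem IsRegularlyGenerated.of_hasRegularSequence [IsNoetherianRing R] [IsLocalRing R]
    {J : Ideal R} (hJ : J ≤ maximalIdeal R) (hJ0 : J ≠ ⊥) (k : ℕ) :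
    ∀ {A : Ideal R} {i : ℕ} (t : Finset R), J = A ⊔ Ideal.span t → t.card ≤ k →
    HasRegularSequence J k A → IsRegularlyGenerated A i → IsRegularlyGenerated J (i + k) := by
  classical
  induction k with
  | zero =>
    intro A i t ht hcard _ hA
    obtain rfl : t = ∅ := by simpa using hcard
    simpa [ht] using hA
  | succ k ih =>
    intro A i t ht hcard hseq hA
    have hAJ : A ≤ J := ht ▸ le_sup_left
    have hC : ¬ J ≤ A ⊔ maximalIdeal R • J := fun h => by
      have hJA : J ≤ A := Submodule.le_of_le_smul_of_le_jacobson_bot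
        (IsNoetherian.noetherian J) (maximalIdeal_le_jacobson _) h
      have h1 := hseq.mem_of_forall_mul_mem 1 fun j hj => by simpa using hJA hj
      exact (maximalIdeal.isMaximal R).ne_top
        (Ideal.eq_top_iff_one _ |>.2 (hJ (hAJ h1)))
    obtain ⟨z, hzJ, hzC, hz, -⟩ := exists_isRegularModulo_not_mem hC hseq.mem_of_forall_mul_mem hseq.mem_of_forall_mul_mem
    have hz' := hzJ
    rw [ht] at hz'
    obtain ⟨a, ha, s, hs, rfl⟩ := Submodule.mem_sup.1 hz'
    obtain ⟨c, -, rfl⟩ := Submodule.mem_span_finset.1 hs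
    have hunit : ∃ x ∈ t, IsUnit (c x) := by
      by_contra! hcon
      refine hzC (Submodule.add_mem_sup ha (Submodule.sum_mem _ fun x hx => ?_))
      exact Submodule.smul_mem_smul ((mem_maximalIdeal _).2 (hcon x hx))
        (ht ▸ Ideal.mem_sup_right (Ideal.subset_span hx))
    obtain ⟨x, hx, hcx⟩ := hunit
    have hle : Ideal.span (t : Set R) ≤
        (A ⊔ Ideal.span {a + ∑ y ∈ t, c y • y}) ⊔ Ideal.span (t.erase x) := by
      have herase : ∀ y ∈ t.erase x, y ∈
          (A ⊔ Ideal.span {a + ∑ y ∈ t, c y • y}) ⊔ Ideal.span (t.erase x) :=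
        fun y hy => Ideal.mem_sup_right (Ideal.subset_span hy)
      refine Ideal.span_le.2 fun y hy => ?_
      by_cases hyx : y = x
      · subst hyx
        refine (Ideal.unit_mul_mem_iff_mem _ hcx).1 ?_
        have hsum := Finset.add_sum_erase t (fun y => c y • y) hx
        rw [show c y * y = (a + ∑ y ∈ t, c y • y) - a - ∑ x ∈ t.erase y, c x • x by
          rw [← hsum]; simp only [smul_eq_mul]; ring]
        refine Ideal.sub_mem _ (Ideal.sub_mem _ ?_ ?_) ?_
        · exact Ideal.mem_sup_left (Ideal.mem_sup_right (Ideal.mem_span_singleton_self _))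
        · exact Ideal.mem_sup_left (Ideal.mem_sup_left ha)
        · exact Submodule.sum_mem _ fun x hx => Ideal.mul_mem_left _ _ (herase x hx)
      · exact herase y (Finset.mem_erase.2 ⟨hyx, hy⟩)
    rw [Nat.add_comm k 1, ← add_assoc]
    refine ih (t.erase x) (le_antisymm ?_ ?_) ?_ (hseq.sup_span_singleton hJ hJ0 k hzJ hz)
      (hA.sup hz)
    · conv_lhs => rw [ht]
      exact sup_le (le_sup_left.trans le_sup_left) hle
    · refine sup_le (sup_le hAJ ((Ideal.span_singleton_le_iff_mem _).2 hzJ)) ?_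
      refine (Ideal.span_mono (by simp)).trans (ht ▸ le_sup_right : Ideal.span (t : Set R) ≤ J)
    · rw [Finset.card_erase_of_mem hx]; omega

theorem hasRegularSequence_of_isWeaklyRegular {J : Ideal R} {rs : List R} (hJ : ∀ x ∈ rs, x ∈ J)
    (h : RingTheory.Sequence.IsWeaklyRegular R rs) : HasRegularSequence J rs.length ⊥ := by
  have key : ∀ k i, i + k = rs.length → HasRegularSequence J k (Ideal.ofList (rs.take i)) := by
    intro k
    induction k with
    | zero => intros; trivial
    | succ k ih =>
      intro i hi
      have hlt : i < rs.length := by omega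
      refine ⟨rs[i], hJ _ (List.getElem_mem hlt), fun r hr => ?_, ?_⟩
      · have := h.regular_mod_prev i hlt
        rw [smul_eq_mul, Ideal.mul_top] at this
        rw [← Ideal.Quotient.eq_zero_iff_mem] at hr ⊢
        exact this ((show rs[i] • Ideal.Quotient.mk _ r = 0 from hr).trans (smul_zero _).symm)
      · have := ih (i + 1) (by omega)
        rwa [List.take_succ_eq_append_getElem hlt, Ideal.ofList_append, Ideal.ofList_singleton]
          at this
  simpa using key rs.length 0 (by simp)

end RegularModulo

section PowerFiltration

variable {R : Type*} [CommRing R]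

theorem sup_pow_succ (A B : Ideal R) (n : ℕ) :
    (A ⊔ B) ^ (n + 1) = A ^ (n + 1) ⊔ B * (A ⊔ B) ^ n := by
  apply le_antisymm
  · induction n with
    | zero => simp
    | succ n ih =>
      calc (A ⊔ B) ^ (n + 1 + 1) = A * (A ⊔ B) ^ (n + 1) ⊔ B * (A ⊔ B) ^ (n + 1) := by
            rw [pow_succ' _ (n + 1), Ideal.sup_mul]
        _ ≤ _ := ?_
      refine sup_le ?_ le_sup_right
      calc A * (A ⊔ B) ^ (n + 1) ≤ A * (A ^ (n + 1) ⊔ B * (A ⊔ B) ^ n) := Ideal.mul_mono_right ih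
        _ = A ^ (n + 1 + 1) ⊔ B * (A * (A ⊔ B) ^ n) := by
            rw [Ideal.mul_sup, ← pow_succ', mul_left_comm]
        _ ≤ _ := by
            rw [pow_succ' (A ⊔ B) n]
            exact sup_le_sup_left (Ideal.mul_mono_right (Ideal.mul_mono_left le_sup_left)) _
  · refine sup_le (Ideal.pow_right_mono le_sup_left _) ?_
    rw [pow_succ']
    exact Ideal.mul_mono_left le_sup_right

theorem mem_sup_span_singleton_pow_succ {J : Ideal R} {x u : R} {n : ℕ} :
    u ∈ (J ⊔ Ideal.span {x}) ^ (n + 1) ↔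
      ∃ a ∈ J ^ (n + 1), ∃ b ∈ (J ⊔ Ideal.span {x}) ^ n, u = a + x * b := by
  rw [sup_pow_succ, Submodule.mem_sup]
  simp only [Ideal.mem_span_singleton_mul]
  constructor
  · rintro ⟨a, ha, _, ⟨b, hb, rfl⟩, rfl⟩
    exact ⟨a, ha, b, hb, rfl⟩
  · rintro ⟨a, ha, b, hb, rfl⟩
    exact ⟨a, ha, _, ⟨b, hb, rfl⟩, rfl⟩

theorem mem_mul_sup_span_singleton_pow_succ {I J : Ideal R} {x u : R} {n : ℕ} :
    u ∈ I * (J ⊔ Ideal.span {x}) ^ (n + 1) ↔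
      ∃ a ∈ I * J ^ (n + 1), ∃ b ∈ I * (J ⊔ Ideal.span {x}) ^ n, u = a + x * b := by
  rw [sup_pow_succ, Ideal.mul_sup, mul_left_comm, Submodule.mem_sup]
  simp only [Ideal.mem_span_singleton_mul]
  constructor
  · rintro ⟨a, ha, _, ⟨b, hb, rfl⟩, rfl⟩
    exact ⟨a, ha, b, hb, rfl⟩
  · rintro ⟨a, ha, b, hb, rfl⟩
    exact ⟨a, ha, _, ⟨b, hb, rfl⟩, rfl⟩

theorem mem_mul_pow_of_add_mul_mem {I J : Ideal R} {x : R} (hI : J ⊔ Ideal.span {x} ≤ I) {n : ℕ}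
    (hx : IsRegularModulo x (J ^ (n + 1))) {a b : R} (ha : a ∈ J ^ (n + 1))
    (h : a + x * b ∈ I * (J ⊔ Ideal.span {x}) ^ (n + 1)) :
    a ∈ I * J ^ (n + 1) ∧ b ∈ I * (J ⊔ Ideal.span {x}) ^ n := by
  obtain ⟨a', ha', b', hb', heq⟩ := mem_mul_sup_span_singleton_pow_succ.1 h
  have hJ : J ^ (n + 1) ≤ I * (J ⊔ Ideal.span {x}) ^ n := by
    rw [pow_succ']
    exact Ideal.mul_mono (le_sup_left.trans hI) (Ideal.pow_right_mono le_sup_left n)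
  have hb : b' - b ∈ J ^ (n + 1) := hx _ (by
    rw [show x * (b' - b) = a - a' by linear_combination -heq]
    exact Ideal.sub_mem _ ha (Ideal.mul_le_right ha'))
  constructor
  · rw [show a = a' + x * (b' - b) by linear_combination heq]
    have hxI : x ∈ I := hI (Ideal.mem_sup_right (Ideal.mem_span_singleton_self x))
    exact Ideal.add_mem _ ha' (Ideal.mul_mem_mul hxI hb)
  · rw [← sub_sub_cancel b' b]
    exact Ideal.sub_mem _ hb' (hJ hb)

theorem IsRegularModulo.pow_right {J : Ideal R} {w : R}
    (h : ∀ n, ∀ u ∈ J ^ n, w * u ∈ J * J ^ n → u ∈ J * J ^ n) (n : ℕ) :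
    IsRegularModulo w (J ^ n) := by
  induction n with
  | zero => intro r _; simp
  | succ n ih =>
    intro r hr
    rw [pow_succ'] at hr ⊢
    exact h n r (ih r (Ideal.mul_le_right hr)) hr

/-- `J ^ n ⧸ I * J ^ n` is a free `R ⧸ I`-module for `J` regularly generated and `J ≤ I`,
so an element regular on `R ⧸ I` is regular on it. -/
theorem IsRegularlyGenerated.mem_mul_pow_of_mul_mem {J : Ideal R} {d : ℕ}
    (hJ : IsRegularlyGenerated J d) : ∀ {I : Ideal R}, J ≤ I → ∀ {w : R}, IsRegularModulo w I →
    ∀ n, ∀ u ∈ J ^ n, w * u ∈ I * J ^ n → u ∈ I * J ^ n := by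
  induction hJ with
  | bot =>
    intro I _ w hw n u hu h
    cases n with
    | zero => simpa using hw u (by simpa using h)
    | succ n =>
      obtain rfl : u = 0 := by simpa using hu
      exact Ideal.zero_mem _
  | @sup J d x hJ hx ih =>
    intro I hI w hw n
    induction n with
    | zero => intro u _ h; simpa using hw u (by simpa using h)
    | succ n ihn =>
      intro u hu h
      obtain ⟨a, ha, b, hb, rfl⟩ := mem_sup_span_singleton_pow_succ.1 hu
      rw [show w * (a + x * b) = w * a + x * (w * b) by ring] at h
      obtain ⟨h1, h2⟩ := mem_mul_pow_of_add_mul_mem hI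
        (IsRegularModulo.pow_right (ih le_rfl hx) _) (Ideal.mul_mem_left _ w ha) h
      exact mem_mul_sup_span_singleton_pow_succ.2
        ⟨a, ih (le_sup_left.trans hI) hw _ a ha h1, b, ihn b hb h2, rfl⟩

theorem IsRegularlyGenerated.isRegularModulo_pow {J : Ideal R} {d : ℕ}
    (hJ : IsRegularlyGenerated J d) {w : R} (hw : IsRegularModulo w J) (n : ℕ) :
    IsRegularModulo w (J ^ n) :=
  IsRegularModulo.pow_right (hJ.mem_mul_pow_of_mul_mem le_rfl hw) n

end PowerFiltration

section Length

variable {R : Type*} [CommRing R]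

theorem length_quotient_ker_eq {M N : Type*} [AddCommGroup M] [Module R M] [AddCommGroup N]
    [Module R N] (f : M →ₗ[R] N) (hf : Function.Surjective f) {K : Submodule R M}
    (hK : LinearMap.ker f = K) : Module.length R (M ⧸ K) = Module.length R N := by
  subst hK
  exact (f.quotKerEquivOfSurjective hf).length_eq

theorem length_le_of_ker_le {M N N' : Type*} [AddCommGroup M] [Module R M] [AddCommGroup N]
    [Module R N] [AddCommGroup N'] [Module R N'] (f : M →ₗ[R] N) (hf : Function.Surjective f)
    (g : M →ₗ[R] N') (h : LinearMap.ker g ≤ LinearMap.ker f) :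
    Module.length R N ≤ Module.length R N' :=
  calc Module.length R N = Module.length R (M ⧸ LinearMap.ker f) :=
        (length_quotient_ker_eq f hf rfl).symm
    _ ≤ Module.length R (M ⧸ LinearMap.ker g) :=
        Module.length_le_of_surjective _ (Submodule.factor_surjective h)
    _ = Module.length R (LinearMap.range g) := g.quotKerEquivRange.length_eq
    _ ≤ _ := Module.length_le_of_injective _ (LinearMap.range g).subtype_injective

/-- The length of `A ⧸ (A ∩ B)`. -/
noncomputable def relativeLength (A B : Ideal R) : ℕ∞ :=
  Module.length R (↥A ⧸ Submodule.comap A.subtype B)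

theorem length_quotient_eq_add {A B : Ideal R} (h : B ≤ A) :
    Module.length R (R ⧸ B) = Module.length R (R ⧸ A) + relativeLength A B := by
  rw [add_comm]
  refine Module.length_eq_add_of_exact
    (Submodule.mapQ (Submodule.comap A.subtype B) B A.subtype le_rfl) (Submodule.factor h)
    ?_ (Submodule.factor_surjective h) ?_
  · rw [← LinearMap.ker_eq_bot, Submodule.ker_mapQ]
    exact Submodule.mkQ_map_self _
  · rw [LinearMap.exact_iff, Submodule.range_mapQ, Submodule.range_subtype]
    ext x
    obtain ⟨x, rfl⟩ := Submodule.mkQ_surjective B x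
    simp only [LinearMap.mem_ker, Submodule.mem_map]
    constructor
    · intro hx
      exact ⟨x, (Submodule.Quotient.mk_eq_zero A).1 hx, rfl⟩
    · rintro ⟨y, hy, hxy⟩
      rw [← hxy]
      exact (Submodule.Quotient.mk_eq_zero A).2 hy

theorem length_quotient_mono {A B : Ideal R} (h : B ≤ A) :
    Module.length R (R ⧸ A) ≤ Module.length R (R ⧸ B) := by
  rw [length_quotient_eq_add h]
  exact le_self_add

theorem relativeLength_mono (A : Ideal R) {B C : Ideal R} (h : C ≤ B) :
    relativeLength A B ≤ relativeLength A C :=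
  Module.length_le_of_surjective _ (Submodule.factor_surjective (Submodule.comap_mono h))

theorem relativeLength_top (B : Ideal R) : relativeLength ⊤ B = Module.length R (R ⧸ B) := by
  simpa using (length_quotient_eq_add (le_top : B ≤ ⊤)).symm

theorem relativeLength_mul_sup_span_singleton {I J : Ideal R} {x : R}
    (hI : J ⊔ Ideal.span {x} ≤ I) {n : ℕ} (hx : IsRegularModulo x (J ^ (n + 1))) :
    relativeLength ((J ⊔ Ideal.span {x}) ^ (n + 1)) (I * (J ⊔ Ideal.span {x}) ^ (n + 1)) =
      relativeLength (J ^ (n + 1)) (I * J ^ (n + 1)) +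
      relativeLength ((J ⊔ Ideal.span {x}) ^ n) (I * (J ⊔ Ideal.span {x}) ^ n) := by
  set K := J ⊔ Ideal.span {x}
  let f : ↥(J ^ (n + 1)) × ↥(K ^ n) →ₗ[R] ↥(K ^ (n + 1)) :=
    LinearMap.codRestrict _
      (LinearMap.coprod (J ^ (n + 1)).subtype (LinearMap.mulLeft R x ∘ₗ (K ^ n).subtype))
      fun p => mem_sup_span_singleton_pow_succ.2 ⟨_, p.1.2, _, p.2.2, rfl⟩
  have hf : Function.Surjective f := by
    rintro ⟨u, hu⟩
    obtain ⟨a, ha, b, hb, rfl⟩ := mem_sup_span_singleton_pow_succ.1 hu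
    exact ⟨(⟨a, ha⟩, ⟨b, hb⟩), rfl⟩
  let P := Submodule.comap (J ^ (n + 1)).subtype (I * J ^ (n + 1))
  let Q := Submodule.comap (K ^ n).subtype (I * K ^ n)
  have hker : LinearMap.ker
      ((Submodule.comap (K ^ (n + 1)).subtype (I * K ^ (n + 1))).mkQ ∘ₗ f) = P.prod Q := by
    rw [LinearMap.ker_comp, Submodule.ker_mkQ]
    ext ⟨a, b⟩
    constructor
    · intro h
      exact mem_mul_pow_of_add_mul_mem hI hx a.2 h
    · rintro ⟨h1, h2⟩
      exact mem_mul_sup_span_singleton_pow_succ.2 ⟨_, h1, _, h2, rfl⟩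
  rw [relativeLength, ← length_quotient_ker_eq _
    ((Submodule.mkQ_surjective _).comp hf : Function.Surjective
      ((Submodule.comap (K ^ (n + 1)).subtype (I * K ^ (n + 1))).mkQ ∘ₗ f)) hker,
    length_quotient_ker_eq (LinearMap.prodMap P.mkQ Q.mkQ)
      ((Submodule.mkQ_surjective P).prodMap (Submodule.mkQ_surjective Q))
      (by rw [LinearMap.ker_prodMap, Submodule.ker_mkQ, Submodule.ker_mkQ]),
    Module.length_prod]
  rfl

/-- For `J` generated by a regular sequence of length `d` and `J ≤ I`, the `R ⧸ I`-module
`J ^ n ⧸ I * J ^ n` has the length of a free module on the monomials of degree `n`. -/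
theorem IsRegularlyGenerated.relativeLength_mul_pow {J : Ideal R} {d : ℕ}
    (hJ : IsRegularlyGenerated J d) : ∀ {I : Ideal R}, J ≤ I → ∀ n,
    relativeLength (J ^ n) (I * J ^ n) = Module.length R (R ⧸ I) * (d.multichoose n : ℕ) := by
  have zero (J I : Ideal R) : relativeLength (J ^ 0) (I * J ^ 0) = Module.length R (R ⧸ I) := by
    rw [pow_zero, mul_one, Ideal.one_eq_top, relativeLength_top]
  induction hJ with
  | bot =>
    intro I _ n
    cases n with
    | zero => rw [zero]; simp
    | succ n =>
      have : Subsingleton ↥((⊥ : Ideal R) ^ (n + 1)) := by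
        simp only [pow_succ, Ideal.mul_bot]
        infer_instance
      simp [relativeLength]
  | @sup J d x hJ hx ih =>
    intro I hI n
    induction n with
    | zero => rw [zero]; simp
    | succ n ihn =>
      rw [relativeLength_mul_sup_span_singleton hI (hJ.isRegularModulo_pow hx _),
        ih (le_sup_left.trans hI), ihn, ← mul_add, Nat.multichoose_succ_succ]
      push_cast
      rfl

theorem IsRegularlyGenerated.length_quotient_pow {J : Ideal R} {d : ℕ}
    (hJ : IsRegularlyGenerated J d) (n : ℕ) : Module.length R (R ⧸ J ^ (n + 1)) =
      Module.length R (R ⧸ J) * ((d + 1).multichoose n : ℕ) := by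
  induction n with
  | zero => rw [zero_add, pow_one]; simp
  | succ n ih =>
    rw [length_quotient_eq_add (Ideal.pow_le_pow_right (Nat.le_succ (n + 1))), ih,
      pow_succ' J (n + 1), hJ.relativeLength_mul_pow le_rfl, ← mul_add,
      Nat.multichoose_succ_succ, add_comm]
    push_cast
    rfl

end Length

section MinimalReduction

variable {R : Type*} [CommRing R]

theorem multiset_prod_map_mul_sub_mem {ι : Type*} {K J : Ideal R} {x a : ι → R} {i : ι}
    (hx : ∀ j, x j ∈ J) (hK : ∀ j, a i * x j - a j * x i ∈ K) (m : Multiset ι) :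
    (m.map fun j => a i * x j).prod - (m.map fun j => a j * x i).prod ∈
      K * J ^ (Multiset.card m - 1) := by
  induction m using Multiset.induction_on with
  | empty => simp
  | cons j m ih =>
    have hprod : (m.map fun j => a i * x j).prod ∈ J ^ Multiset.card m := by
      clear ih
      induction m using Multiset.induction_on with
      | empty => simp
      | cons j m ih =>
        rw [Multiset.map_cons, Multiset.prod_cons, Multiset.card_cons, pow_succ']
        exact Ideal.mul_mem_mul (J.mul_mem_left _ (hx j)) ih
    rw [Multiset.map_cons, Multiset.map_cons, Multiset.prod_cons, Multiset.prod_cons,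
      Multiset.card_cons, Nat.add_sub_cancel]
    set P := (m.map fun j => a i * x j).prod
    set Q := (m.map fun j => a j * x i).prod with hQ
    rw [show a i * x j * P - a j * x i * Q = (a i * x j - a j * x i) * P + a j * x i * (P - Q) by
      ring]
    refine Ideal.add_mem _ (Ideal.mul_mem_mul (hK j) hprod) ?_
    rcases m.empty_or_exists_mem with rfl | ⟨k, hk⟩
    · simp [P, Q]
    · have hcard : Multiset.card m = 1 + (Multiset.card m - 1) := by
        have := Multiset.card_pos_iff_exists_mem.2 ⟨k, hk⟩
        omega
      rw [hcard, pow_add, pow_one, mul_left_comm]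
      exact Ideal.mul_mem_mul (J.mul_mem_left _ (hx i)) ih

theorem pow_add_eq_pow_mul_pow {I J : Ideal R} {r : ℕ} (h : I ^ (r + 1) = J * I ^ r) (n : ℕ) :
    I ^ (n + r) = J ^ n * I ^ r := by
  induction n with
  | zero => simp
  | succ n ih =>
    rw [show n + 1 + r = n + r + 1 by ring, pow_succ', ih, mul_left_comm, ← pow_succ', h,
      ← mul_assoc, pow_succ]

theorem exists_eval_ne_zero_of_coeff_ne_zero {k : Type*} [Field k] [Infinite k] {s n : ℕ}
    {c : Sym (Fin s) n → k} {m₀ : Sym (Fin s) n} (hc : c m₀ ≠ 0) :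
    ∃ a : Fin s → k, ∑ m, c m * ((m : Multiset (Fin s)).map a).prod ≠ 0 := by
  classical
  let F : MvPolynomial (Fin s) k :=
    ∑ m, MvPolynomial.C (c m) * ((m : Multiset (Fin s)).map MvPolynomial.X).prod
  have hmon (m : Multiset (Fin s)) :
      (m.map (MvPolynomial.X (R := k))).prod = MvPolynomial.monomial (Multiset.toFinsupp m) 1 := by
    induction m using Multiset.induction_on with
    | empty => simp
    | cons j m ih =>
      rw [Multiset.map_cons, Multiset.prod_cons, ih, ← Multiset.singleton_add, map_add,
        Multiset.toFinsupp_singleton, MvPolynomial.X, MvPolynomial.monomial_mul, one_mul]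
  have hF : F ≠ 0 := fun h => hc <| by
    have := congrArg (MvPolynomial.coeff (Multiset.toFinsupp (m₀ : Multiset (Fin s)))) h
    simpa [F, MvPolynomial.coeff_sum, hmon, MvPolynomial.coeff_monomial, Sym.coe_inj] using this
  by_contra! hcon
  refine hF (MvPolynomial.funext fun a => ?_)
  simpa [F, map_multiset_prod] using hcon a

variable [IsNoetherianRing R] [IsLocalRing R]

/-- A minimal generating set of a minimal reduction is algebraically independent
in the fiber ring. -/
theorem IsMinimalReduction.mem_maximalIdeal_of_sum_mem [Infinite (ResidueField R)]
    {I J : Ideal R} (hJ : IsMinimalReduction J I) {s : ℕ} {x : Fin s → R}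
    (hx : Ideal.span (Set.range x) = J) (hs : s = J.spanFinrank) {n : ℕ}
    {c : Sym (Fin s) n → R}
    (hc : ∑ m, c m * ((m : Multiset (Fin s)).map x).prod ∈ maximalIdeal R * I ^ n)
    (m₀ : Sym (Fin s) n) : c m₀ ∈ maximalIdeal R := by
  by_contra hm₀
  obtain ⟨⟨hJI, r, hr⟩, hmin⟩ := hJ
  obtain ⟨a', ha'⟩ := exists_eval_ne_zero_of_coeff_ne_zero (c := fun m => residue R (c m))
    (m₀ := m₀) fun h => hm₀ ((residue_eq_zero_iff _).1 h)
  choose a ha using fun j => residue_surjective (a' j)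
  obtain rfl : (fun j => residue R (a j)) = a' := funext ha
  set v := ∑ m, c m * ((m : Multiset (Fin s)).map a).prod with hv
  have hvm : v ∉ maximalIdeal R := fun h => ha' <| by
    rw [← residue_eq_zero_iff] at h
    simpa [hv, map_multiset_prod] using h
  have hxJ (j) : x j ∈ J := hx ▸ Ideal.subset_span ⟨j, rfl⟩
  obtain _ | k := n
  · refine hvm ?_
    simpa [hv, Sym.eq_nil_of_card_zero] using hc
  obtain ⟨i, hi⟩ : ∃ i, a i ∉ maximalIdeal R := by
    by_contra! hcon
    refine hvm (Ideal.sum_mem _ fun m _ => Ideal.mul_mem_left _ _ ?_)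
    obtain ⟨j, hj⟩ := Sym.exists_mem m
    exact Ideal.mem_of_dvd _ (Multiset.dvd_prod (Multiset.mem_map_of_mem a hj)) (hcon j)
  have hiu : IsUnit (a i) := by simpa using hi
  let K : Ideal R := Ideal.span ((fun j => a i * x j - a j * x i) '' {j | j ≠ i})
  have hK (j) : a i * x j - a j * x i ∈ K := by
    by_cases hji : j = i
    · simp [hji]
    · exact Ideal.subset_span ⟨j, hji, rfl⟩
  have hKJ : K ≤ J := Ideal.span_le.2 <| by
    rintro _ ⟨j, -, rfl⟩
    exact J.sub_mem (J.mul_mem_left _ (hxJ j)) (J.mul_mem_left _ (hxJ i))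
  have hJK : J = Ideal.span {x i} ⊔ K := by
    refine le_antisymm ?_ (sup_le ((Ideal.span_singleton_le_iff_mem _).2 (hxJ i)) hKJ)
    rw [← hx, Ideal.span_le]
    rintro _ ⟨j, rfl⟩
    refine (Ideal.unit_mul_mem_iff_mem _ hiu).1 ?_
    rw [← add_sub_cancel (a j * x i) (a i * x j)]
    exact Submodule.add_mem_sup (Ideal.mul_mem_left _ _ (Ideal.mem_span_singleton_self _)) (hK j)
  have hxi : x i ^ (k + 1) ∈ K * J ^ k ⊔ maximalIdeal R * I ^ (k + 1) := by
    have hvu : IsUnit v := by simpa using hvm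
    refine (Ideal.unit_mul_mem_iff_mem _ hvu).1 ?_
    have h1 : ∑ m, c m * ((m : Multiset (Fin s)).map fun j => a i * x j).prod ∈
        maximalIdeal R * I ^ (k + 1) := by
      have := Ideal.mul_mem_left _ (a i ^ (k + 1)) hc
      rw [Finset.mul_sum] at this
      convert this using 2 with m
      rw [Multiset.prod_map_mul]
      simp
      ring
    have h2 : ∑ m, c m * ((m : Multiset (Fin s)).map fun j => a i * x j).prod -
        v * x i ^ (k + 1) ∈ K * J ^ k := by
      rw [hv, Finset.sum_mul, ← Finset.sum_sub_distrib]
      refine Ideal.sum_mem _ fun m _ => ?_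
      have := Ideal.mul_mem_left _ (c m) (multiset_prod_map_mul_sub_mem hxJ hK (m : Multiset _))
      rw [Multiset.prod_map_mul (g := fun _ => x i)] at this
      simpa [mul_sub, mul_assoc, pow_succ'] using this
    rw [← sub_sub_cancel (∑ m, c m * ((m : Multiset (Fin s)).map fun j => a i * x j).prod)
      (v * x i ^ (k + 1))]
    exact Ideal.sub_mem _ (Ideal.mem_sup_right h1) (Ideal.mem_sup_left h2)
  have hJpow : J ^ (k + 1) ≤ K * J ^ k ⊔ maximalIdeal R * I ^ (k + 1) := by
    calc J ^ (k + 1) = Ideal.span {x i} ^ (k + 1) ⊔ K * J ^ k := by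
          conv_lhs => rw [hJK, sup_pow_succ, ← hJK]
      _ ≤ _ := by
          rw [Ideal.span_singleton_pow]
          exact sup_le ((Ideal.span_singleton_le_iff_mem _).2 hxi) le_sup_left
  have hred : I ^ (k + r + 1) = K * I ^ (k + r) := by
    apply le_antisymm
    · refine Submodule.le_of_le_smul_of_le_jacobson_bot (I := maximalIdeal R)
        (IsNoetherian.noetherian (I ^ (k + r + 1))) (maximalIdeal_le_jacobson _) ?_
      calc I ^ (k + r + 1) = J ^ (k + 1) * I ^ r := by
            rw [add_right_comm, pow_add_eq_pow_mul_pow hr]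
        _ ≤ (K * J ^ k ⊔ maximalIdeal R * I ^ (k + 1)) * I ^ r := Ideal.mul_mono_left hJpow
        _ = K * (J ^ k * I ^ r) ⊔ maximalIdeal R * I ^ (k + r + 1) := by
            rw [Ideal.sup_mul, mul_assoc, mul_assoc, ← pow_add, add_right_comm]
        _ = _ := by rw [← pow_add_eq_pow_mul_pow hr, smul_eq_mul]
    · rw [pow_succ']
      exact Ideal.mul_mono_left (hKJ.trans hJI)
  have hfin : ((fun j => a i * x j - a j * x i) '' {j | j ≠ i}).Finite := Set.toFinite _
  have hle : K.spanFinrank ≤ ({j | j ≠ i} : Set (Fin s)).ncard :=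
    (Submodule.spanFinrank_span_le_ncard_of_finite hfin).trans (Set.ncard_image_le (Set.toFinite _))
  rw [hmin K hKJ ⟨hKJ.trans hJI, k + r, hred⟩, ← hs] at hle
  have hlt : ({j | j ≠ i} : Set (Fin s)).ncard < (Set.univ : Set (Fin s)).ncard :=
    Set.ncard_lt_ncard ((Set.ssubset_univ_iff).2 fun h => (h ▸ Set.mem_univ i : i ∈ {j | j ≠ i}) rfl)
  simp only [Set.ncard_univ, Nat.card_eq_fintype_card, Fintype.card_fin] at hlt
  omega

theorem IsMinimalReduction.multichoose_le_relativeLength [Infinite (ResidueField R)]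
    {I J : Ideal R} (hJ : IsMinimalReduction J I) (n : ℕ) :
    ((J.spanFinrank.multichoose n : ℕ) : ℕ∞) ≤
      relativeLength (I ^ n) (maximalIdeal R * I ^ n) := by
  obtain ⟨t, ht, htJ⟩ := Submodule.FG.exists_span_finset_card_eq_spanFinrank
    (IsNoetherian.noetherian J)
  obtain ⟨s, hs⟩ : ∃ s, s = J.spanFinrank := ⟨_, rfl⟩
  let x : Fin s → R := fun j => (t.equivFinOfCardEq (ht.trans hs.symm)).symm j
  have hx : Ideal.span (Set.range x) = J := by
    rw [← htJ, Ideal.span]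
    congr 1
    change Set.range (Subtype.val ∘ _) = _
    rw [EquivLike.range_comp]
    simp
  have hmon (m : Sym (Fin s) n) : ((m : Multiset (Fin s)).map x).prod ∈ I ^ n := by
    obtain ⟨m, rfl⟩ := m
    refine Ideal.pow_right_mono hJ.1.1 _ ?_
    change (m.map x).prod ∈ _
    induction m using Multiset.induction_on with
    | empty => simp
    | cons j m ih =>
      rw [Multiset.map_cons, Multiset.prod_cons, Multiset.card_cons, pow_succ']
      exact Ideal.mul_mem_mul (hx ▸ Ideal.subset_span ⟨j, rfl⟩) ih
  let g : (Sym (Fin s) n → R) →ₗ[R] ↥(I ^ n) :=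
    Fintype.linearCombination R fun m => ⟨_, hmon m⟩
  have hg (c : Sym (Fin s) n → R) :
      (g c : R) = ∑ m, c m * ((m : Multiset (Fin s)).map x).prod := by
    simp [g, Fintype.linearCombination_apply]
  let f : (Sym (Fin s) n → R) →ₗ[R] (Sym (Fin s) n → R ⧸ maximalIdeal R) :=
    (maximalIdeal R).mkQ.compLeft _
  have hf : Function.Surjective f := (Submodule.mkQ_surjective _).comp_left
  have hsimple : IsSimpleModule R (R ⧸ maximalIdeal R) :=
    isSimpleModule_iff_isCoatom.2 (Ideal.isMaximal_def.1 inferInstance)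
  have := length_le_of_ker_le f hf
    ((Submodule.comap (I ^ n).subtype (maximalIdeal R * I ^ n)).mkQ ∘ₗ g) (by
      rw [LinearMap.ker_comp, Submodule.ker_mkQ]
      intro c hc
      have hc' : (g c : R) ∈ maximalIdeal R * I ^ n := hc
      rw [hg] at hc'
      exact funext fun m => (Submodule.Quotient.mk_eq_zero _).2
        (hJ.mem_maximalIdeal_of_sum_mem hx hs hc' m))
  rwa [Module.length_pi, Module.length_eq_one, mul_one, ENat.card_eq_coe_fintype_card,
    Sym.card_sym_fin_eq_multichoose, hs] at this

theorem IsMinimalReduction.multichoose_le_length_quotient_pow [Infinite (ResidueField R)]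
    {I J : Ideal R} (hI : I ≤ maximalIdeal R) (hJ : IsMinimalReduction J I) (n : ℕ) :
    (((J.spanFinrank + 1).multichoose n : ℕ) : ℕ∞) ≤ Module.length R (R ⧸ I ^ (n + 1)) := by
  have hstep (k : ℕ) : ((J.spanFinrank.multichoose k : ℕ) : ℕ∞) ≤
      relativeLength (I ^ k) (I ^ (k + 1)) :=
    (hJ.multichoose_le_relativeLength k).trans
      (relativeLength_mono _ (by rw [pow_succ']; exact Ideal.mul_mono_left hI))
  induction n with
  | zero =>
    have := hstep 0
    rw [pow_zero, Ideal.one_eq_top, relativeLength_top] at this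
    simpa using this
  | succ n ih =>
    rw [length_quotient_eq_add (Ideal.pow_le_pow_right (Nat.le_succ (n + 1))),
      Nat.multichoose_succ_succ, add_comm, Nat.cast_add]
    exact add_le_add ih (hstep (n + 1))

end MinimalReduction

section Asymptotics

open Filter Topology

theorem tendsto_choose_add_div_pow (a : ℕ) {k D : ℕ} (hk : k ≤ D) :
    Tendsto (fun n : ℕ => ((n + a).choose k : ℝ) / (n : ℝ) ^ D) atTop
      (𝓝 (if k = D then 1 / (D.factorial : ℝ) else 0)) := by
  have h1 : Tendsto (fun n : ℕ => (n.choose k : ℝ) / (n : ℝ) ^ k) atTop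
      (𝓝 (1 / (k.factorial : ℝ))) := by
    have h := (Asymptotics.isEquivalent_iff_tendsto_one (by
      filter_upwards [eventually_gt_atTop 0] with n hn
      positivity)).mp (isEquivalent_choose k)
    have h := h.mul_const (1 / (k.factorial : ℝ))
    rw [one_mul] at h
    refine h.congr' ?_
    filter_upwards [eventually_gt_atTop 0] with n hn
    simp only [Pi.div_apply]
    field_simp
  have h2 : Tendsto (fun n : ℕ => (((n + a : ℕ) : ℝ) / n) ^ k) atTop (𝓝 1) := by
    have : Tendsto (fun n : ℕ => 1 + (a : ℝ) / (n : ℝ)) atTop (𝓝 (1 + 0)) :=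
      tendsto_const_nhds.add (tendsto_const_div_atTop_nhds_zero_nat _)
    have := (this.pow k)
    rw [add_zero, one_pow] at this
    refine this.congr' ?_
    filter_upwards [eventually_gt_atTop 0] with n hn
    congr 1
    push_cast
    field_simp
  have h3 : Tendsto (fun n : ℕ => (1 / (n : ℝ)) ^ (D - k)) atTop (𝓝 (if k = D then 1 else 0)) := by
    split_ifs with h
    · simp [h]
    · have := (tendsto_const_div_atTop_nhds_zero_nat (1 : ℝ)).pow (D - k)
      rwa [zero_pow (by omega)] at this
  have h4 := ((h1.comp (tendsto_add_atTop_nat a)).mul h2).mul h3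
  have hlim : 1 / (k.factorial : ℝ) * 1 * (if k = D then 1 else 0) =
      if k = D then 1 / (D.factorial : ℝ) else 0 := by
    split_ifs with h <;> simp [h]
  rw [hlim] at h4
  refine h4.congr' ?_
  filter_upwards [eventually_gt_atTop 0] with n hn
  obtain ⟨j, rfl⟩ := Nat.exists_eq_add_of_le hk
  have : ((n + a : ℕ) : ℝ) ≠ 0 := by positivity
  simp only [Function.comp, Nat.add_sub_cancel_left]
  rw [div_pow, one_div, inv_pow, pow_add]
  field_simp

/-- The Hilbert polynomial with coefficients `e` in dimension `d`. -/
def hilbertSum (d : ℕ) (e : ℕ → ℤ) (n : ℕ) : ℤ :=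
  ∑ i ∈ Finset.range (d + 1), (-1 : ℤ) ^ i * e i * ((n + d - i).choose (d - i))

theorem tendsto_hilbertSum_div_pow (d : ℕ) (e : ℕ → ℤ) (r : ℕ) {D : ℕ} (hD : d ≤ D) :
    Tendsto (fun n : ℕ => (hilbertSum d e (n + r) : ℝ) / (n : ℝ) ^ D) atTop
      (𝓝 (if d = D then e 0 / (D.factorial : ℝ) else 0)) := by
  have h := tendsto_finsetSum (Finset.range (d + 1)) fun i _ =>
    (tendsto_choose_add_div_pow (r + (d - i)) ((Nat.sub_le d i).trans hD)).const_mul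
      ((-1 : ℝ) ^ i * e i)
  have hlim : (∑ i ∈ Finset.range (d + 1), (-1 : ℝ) ^ i * e i *
      (if d - i = D then 1 / (D.factorial : ℝ) else 0)) =
      if d = D then e 0 / (D.factorial : ℝ) else 0 := by
    rw [Finset.sum_eq_single_of_mem 0 (by simp)]
    · split_ifs with h1 h2 h2
      · simp [div_eq_mul_inv]
      · omega
      · omega
      · simp
    · intro i hi h0
      rw [if_neg (by rw [Finset.mem_range] at hi; omega), mul_zero]
  rw [hlim] at h
  refine h.congr fun n => ?_
  rw [hilbertSum]
  push_cast
  rw [Finset.sum_div]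
  refine Finset.sum_congr rfl fun i hi => ?_
  rw [Finset.mem_range] at hi
  rw [show n + r + d - i = n + (r + (d - i)) by omega, mul_div_assoc]

theorem le_of_choose_le_hilbertSum {d s N : ℕ} {e : ℕ → ℤ}
    (h : ∀ n ≥ N, ((n + s).choose s : ℤ) ≤ hilbertSum d e n) : s ≤ d := by
  by_contra! hs
  have h1 := tendsto_choose_add_div_pow s (le_refl s)
  have h2 := tendsto_hilbertSum_div_pow d e 0 hs.le
  rw [if_pos rfl] at h1
  rw [if_neg hs.ne] at h2
  have := le_of_tendsto_of_tendsto h1 h2 (by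
    filter_upwards [eventually_ge_atTop N] with n hn
    gcongr
    exact_mod_cast h n hn)
  have : (0 : ℝ) < 1 / (s.factorial : ℝ) := by positivity
  linarith

theorem eq_of_choose_le_hilbertSum {d N r c : ℕ} {e : ℕ → ℤ}
    (hle : ∀ n ≥ N, hilbertSum d e n ≤ c * (n + d).choose d)
    (hge : ∀ n ≥ N, (c * (n + d).choose d : ℤ) ≤ hilbertSum d e (n + r)) : (c : ℤ) = e 0 := by
  have h1 := (tendsto_choose_add_div_pow d (le_refl d)).const_mul (c : ℝ)
  have h2 := tendsto_hilbertSum_div_pow d e 0 le_rfl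
  have h3 := tendsto_hilbertSum_div_pow d e r le_rfl
  rw [if_pos rfl] at h1 h2 h3
  have h4 := le_of_tendsto_of_tendsto h2 h1 (by
    filter_upwards [eventually_ge_atTop N] with n hn
    rw [← mul_div_assoc]
    gcongr
    exact_mod_cast hle n hn)
  have h5 := le_of_tendsto_of_tendsto h1 h3 (by
    filter_upwards [eventually_ge_atTop N] with n hn
    rw [← mul_div_assoc]
    gcongr
    exact_mod_cast hge n hn)
  have hd : (0 : ℝ) < d.factorial := by positivity
  rw [mul_one_div, div_le_div_iff_of_pos_right hd] at h4 h5
  exact_mod_cast le_antisymm h5 h4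

end Asymptotics

section HilbertFunction

variable {R : Type*} [CommRing R]

theorem moduleLength_eq_coe_iff {M : Type*} [AddCommGroup M] [Module R M] {l : ℕ} :
    moduleLength R M = (l : WithBot ℕ∞) ↔ Module.length R M = l := by
  rw [moduleLength, ← Module.coe_length]
  exact WithBot.coe_inj

theorem HasRegularSequence.ne_bot_of_le_radical [Nontrivial R] {K J : Ideal R} {n : ℕ}
    (hK : HasRegularSequence K (n + 1) ⊥) (hrad : K ≤ J.radical) : J ≠ ⊥ := by
  rintro rfl
  obtain ⟨z, hz, hreg, -⟩ := hK
  obtain ⟨k, hk⟩ := hrad hz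
  refine one_ne_zero (α := R) ?_
  simpa using hreg.pow k 1 (by simpa using hk)

theorem IsReduction.radical_eq {I J : Ideal R} (h : IsReduction J I) : J.radical = I.radical := by
  obtain ⟨hle, r, hr⟩ := h
  refine le_antisymm (Ideal.radical_mono hle) ?_
  rw [← Ideal.radical_pow I r.succ_ne_zero]
  exact Ideal.radical_mono (hr.trans_le Ideal.mul_le_left)

theorem IsCohenMacaulayLocalRing.isRegularlyGenerated [IsNoetherianRing R] [IsLocalRing R]
    (hCM : IsCohenMacaulayLocalRing R) {d : ℕ} (hdim : ringKrullDim R = d) (hd : 0 < d)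
    {J : Ideal R} (hJ : J.radical = maximalIdeal R) (hs : J.spanFinrank ≤ d) :
    IsRegularlyGenerated J d := by
  obtain ⟨rs, hmem, hreg, hlen⟩ := hCM
  obtain rfl : rs.length = d := by
    rw [hdim] at hlen
    exact_mod_cast hlen
  have hm := hasRegularSequence_of_isWeaklyRegular hmem hreg.toIsWeaklyRegular
  obtain ⟨n, hn⟩ := Nat.exists_eq_succ_of_ne_zero hd.ne'
  rw [hn] at hm hs ⊢
  have hJm : J ≤ maximalIdeal R := hJ ▸ Ideal.le_radical
  have hJ0 : J ≠ ⊥ := hm.ne_bot_of_le_radical hJ.ge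
  have h := hm.of_le_radical le_rfl (hm.ne_bot_of_le_radical Ideal.le_radical) hJm hJ.ge
  obtain ⟨t, ht, hspan⟩ := Submodule.FG.exists_span_finset_card_eq_spanFinrank
    (IsNoetherian.noetherian J)
  simpa using IsRegularlyGenerated.of_hasRegularSequence hJm hJ0 (n + 1) t
    (by rw [bot_sup_eq]; exact hspan.symm) (ht.trans_le hs) h .bot

theorem HasHilbertCoeffs.exists_length_eq {I : Ideal R} {d : ℕ} {e : ℕ → ℤ}
    (h : HasHilbertCoeffs I d e) : ∃ N, ∀ n ≥ N, ∃ l : ℕ,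
      Module.length R (R ⧸ I ^ (n + 1)) = l ∧ (l : ℤ) = hilbertSum d e n := by
  obtain ⟨N, hN⟩ := h
  exact ⟨N, fun n hn => (hN n hn).imp fun l hl => ⟨moduleLength_eq_coe_iff.1 hl.1, hl.2⟩⟩

theorem HasHilbertCoeffs.length_quotient_pow_ne_top {I : Ideal R} {d : ℕ} {e : ℕ → ℤ}
    (h : HasHilbertCoeffs I d e) (n : ℕ) : Module.length R (R ⧸ I ^ n) ≠ ⊤ := by
  obtain ⟨N, hN⟩ := h.exists_length_eq
  obtain ⟨l, hl, -⟩ := hN (N + n) (Nat.le_add_right N n)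
  exact ne_top_of_le_ne_top (hl ▸ ENat.natCast_ne_top l)
    (length_quotient_mono (Ideal.pow_le_pow_right (by omega)))

theorem IsMinimalReduction.spanFinrank_le [IsNoetherianRing R] [IsLocalRing R]
    [Infinite (ResidueField R)] {I J : Ideal R} (hI : I ≤ maximalIdeal R)
    (hJ : IsMinimalReduction J I) {d : ℕ} {e : ℕ → ℤ} (he : HasHilbertCoeffs I d e) :
    J.spanFinrank ≤ d := by
  obtain ⟨N, hN⟩ := he.exists_length_eq
  refine le_of_choose_le_hilbertSum (N := N) (e := e) fun n hn => ?_
  obtain ⟨l, hl, hl'⟩ := hN n hn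
  have h := hJ.multichoose_le_length_quotient_pow hI n
  rw [hl, Nat.multichoose_eq, Nat.cast_le,
    show J.spanFinrank + 1 + n - 1 = n + J.spanFinrank by omega, Nat.choose_symm_add] at h
  rw [← hl']
  exact_mod_cast h

theorem length_quotient_pow_succ_eq {J : Ideal R} {d c : ℕ} (hJ : IsRegularlyGenerated J d)
    (hc : Module.length R (R ⧸ J) = c) (n : ℕ) :
    Module.length R (R ⧸ J ^ (n + 1)) = (c * (n + d).choose d : ℕ) := by
  rw [hJ.length_quotient_pow, hc, Nat.multichoose_eq,
    show d + 1 + n - 1 = n + d by omega, Nat.choose_symm_add, Nat.cast_mul]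

/-- The multiplicity of `I` is the colength of a reduction generated by a regular sequence. -/
theorem IsReduction.length_quotient_eq {I J : Ideal R} (h : IsReduction J I) {d c : ℕ}
    {e : ℕ → ℤ} (he : HasHilbertCoeffs I d e) (hJ : IsRegularlyGenerated J d)
    (hc : Module.length R (R ⧸ J) = c) : (c : ℤ) = e 0 := by
  obtain ⟨hle, r, hr⟩ := h
  obtain ⟨N, hN⟩ := he.exists_length_eq
  refine eq_of_choose_le_hilbertSum (d := d) (N := N) (r := r) (fun n hn => ?_) fun n hn => ?_
  · obtain ⟨l, hl, hl'⟩ := hN n hn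
    have := length_quotient_mono (Ideal.pow_right_mono hle (n + 1))
    rw [hl, length_quotient_pow_succ_eq hJ hc, Nat.cast_le] at this
    rw [← hl']
    exact_mod_cast this
  · obtain ⟨l, hl, hl'⟩ := hN (n + r) (by omega)
    have hpow : I ^ (n + r + 1) ≤ J ^ (n + 1) := by
      rw [show n + r + 1 = n + 1 + r by omega, pow_add_eq_pow_mul_pow hr]
      exact Ideal.mul_le_left
    have := length_quotient_mono hpow
    rw [hl, length_quotient_pow_succ_eq hJ hc, Nat.cast_le] at this
    rw [← hl']
    exact_mod_cast this

theorem length_quotient_mul_pow_eq {I J : Ideal R} {d c i : ℕ} (hJ : IsRegularlyGenerated J (d + 1))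
    (hle : J ≤ I) (hc : Module.length R (R ⧸ J) = c) (hi : Module.length R (R ⧸ I) = i) (n : ℕ) :
    Module.length R (R ⧸ I * J ^ n) =
      (c * (n + d).choose (d + 1) + i * (n + d).choose d : ℕ) := by
  have h : Module.length R (R ⧸ J ^ n) = (c * (n + d).choose (d + 1) : ℕ) := by
    cases n with
    | zero => simp [Ideal.one_eq_top]
    | succ n => rw [length_quotient_pow_succ_eq hJ hc, show n + (d + 1) = n + 1 + d by omega]
  rw [length_quotient_eq_add (Ideal.mul_le_right : I * J ^ n ≤ J ^ n), h,
    hJ.relativeLength_mul_pow hle, hi, Nat.multichoose_eq,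
    show d + 1 + n - 1 = n + d by omega, Nat.choose_symm_add]
  push_cast
  rfl

end HilbertFunction

/-- **Vasconcelos, Proposition 3.1 (1994)**.  Let `(R, m)` be a Cohen-Macaulay Noetherian
local ring of dimension `d > 0` with infinite residue field, `I` an `m`-primary ideal and
`J` a minimal reduction of `I`.  Then for every `n ≥ 0`,
`λ(R/I^(n+1)) = e₀(I)·C(n+d,d) + (λ(R/I) - e₀(I))·C(n+d-1,d-1) - λ(I^(n+1)/I·J^n)`. -/
theorem hilbert_function_eq_of_minimal_reduction
    {R : Type*} [CommRing R] [IsNoetherianRing R] [IsLocalRing R]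
    (d : ℕ) (hd : 0 < d) (hdim : ringKrullDim R = d)
    (hCM : IsCohenMacaulayLocalRing R)
    (hres : Infinite (IsLocalRing.ResidueField R))
    (I J : Ideal R) (hI : I.radical = maximalIdeal R)
    (hJ : IsMinimalReduction J I)
    (e : ℕ → ℤ) (he : HasHilbertCoeffs I d e) :
    ∀ n : ℕ, ∃ l lI lS : ℕ,
      moduleLength R (R ⧸ I ^ (n + 1)) = (l : WithBot ℕ∞) ∧
      moduleLength R (R ⧸ I) = (lI : WithBot ℕ∞) ∧
      moduleLength R
        (↥(I ^ (n + 1)) ⧸ Submodule.comap (I ^ (n + 1) : Ideal R).subtype (I * J ^ n)) =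
        (lS : WithBot ℕ∞) ∧
      (l : ℤ) = e 0 * ((n + d).choose d) + ((lI : ℤ) - e 0) * ((n + d - 1).choose (d - 1))
        - (lS : ℤ) := by
  have hIm : I ≤ maximalIdeal R := hI ▸ Ideal.le_radical
  have hle : J ≤ I := hJ.1.1
  have hreg : IsRegularlyGenerated J d :=
    hCM.isRegularlyGenerated hdim hd (hJ.1.radical_eq.trans hI) (hJ.spanFinrank_le hIm he)
  have hfin := he.length_quotient_pow_ne_top
  obtain ⟨i, hi⟩ := ENat.ne_top_iff_exists.1 (hfin 1)
  rw [pow_one] at hi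
  have hJfin : Module.length R (R ⧸ J) ≠ ⊤ := by
    obtain ⟨r, hr⟩ := hJ.1.2
    exact ne_top_of_le_ne_top (hfin (r + 1))
      (length_quotient_mono (hr.trans_le Ideal.mul_le_left))
  obtain ⟨c, hc⟩ := ENat.ne_top_iff_exists.1 hJfin
  have hc0 := hJ.1.length_quotient_eq he hreg hc.symm
  obtain ⟨d, rfl⟩ := Nat.exists_eq_succ_of_ne_zero hd.ne'
  intro n
  obtain ⟨l, hl⟩ := ENat.ne_top_iff_exists.1 (hfin (n + 1))
  have hmul : I * J ^ n ≤ I ^ (n + 1) := by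
    rw [pow_succ']
    exact Ideal.mul_mono_right (Ideal.pow_right_mono hle n)
  have h := length_quotient_eq_add hmul
  rw [length_quotient_mul_pow_eq hreg hle hc.symm hi.symm, ← hl] at h
  obtain ⟨s, hs⟩ := ENat.ne_top_iff_exists.1
    (ne_top_of_le_ne_top (ENat.natCast_ne_top _) (le_add_self.trans_eq h.symm))
  refine ⟨l, i, s, moduleLength_eq_coe_iff.2 hl.symm, moduleLength_eq_coe_iff.2 hi.symm,
    moduleLength_eq_coe_iff.2 hs.symm, ?_⟩
  rw [← hs] at h
  have h : c * (n + d).choose (d + 1) + i * (n + d).choose d = l + s := by exact_mod_cast h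
  have hpascal : (n + (d + 1)).choose (d + 1) = (n + d).choose d + (n + d).choose (d + 1) :=
    Nat.choose_succ_succ' _ _
  zify at h
  rw [← hc0, Nat.succ_eq_add_one, hpascal, Nat.add_sub_cancel, ← add_assoc, Nat.add_sub_cancel]
  push_cast
  linear_combination -h
end

section
/- Let (R,m) be a Cohen-Macaulay Noetherian local ring of dimension d > 0 with infinite residue field and let I be an m-primary ideal. If e_0(I) − e_1(I) = λ(R/I) − 1 and e_2(I) ≠ 0, then I has reduction number 2, i.e., r(I) = 2. -/
open Finset IsLocalRing

/-- The reduction number of `I` relative to a reduction `J`: the least `r` with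
`I^(r+1) = J·I^r`. -/
def IsReductionNumberRel {R : Type*} [CommRing R] (J I : Ideal R) (r : ℕ) : Prop :=
  IsLeast {k : ℕ | I ^ (k + 1) = J * I ^ k} r

/-- The reduction number of `I`: the minimum of the reduction numbers of `I` relative to
its minimal reductions. -/
def IsReductionNumber {R : Type*} [CommRing R] (I : Ideal R) (r : ℕ) : Prop :=
  IsLeast {k : ℕ | ∃ J : Ideal R, IsMinimalReduction J I ∧ IsReductionNumberRel J I k} r

universe u

/-- `x` is a nonzerodivisor modulo the ideal `K`. -/
def RegularMod {R : Type*} [CommRing R] (K : Ideal R) (x : R) : Prop :=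
  ∀ z, x * z ∈ K → z ∈ K

/-- The maximal ideal of `R` contains a regular sequence of length `n` on `R ⧸ K`. -/
def DepthGE {R : Type*} [CommRing R] [IsLocalRing R] : ℕ → Ideal R → Prop
  | 0, _ => True
  | n + 1, K => ∃ x ∈ maximalIdeal R, RegularMod K x ∧ DepthGE n (K ⊔ Ideal.span {x})

section Depth

variable {R : Type*} [CommRing R]

theorem mem_sup_span_singleton_s2 {K : Ideal R} {x z : R} :
    z ∈ K ⊔ Ideal.span {x} ↔ ∃ w, z - x * w ∈ K := by
  constructor
  · intro h
    obtain ⟨k, hk, y, hy, rfl⟩ := Submodule.mem_sup.1 h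
    obtain ⟨w, rfl⟩ := Ideal.mem_span_singleton'.1 hy
    exact ⟨w, by simpa [mul_comm] using hk⟩
  · rintro ⟨w, hw⟩
    exact Submodule.mem_sup.2 ⟨_, hw, x * w,
      Ideal.mul_mem_right _ _ (Ideal.mem_span_singleton_self x), by ring⟩

theorem RegularMod.swap {K : Ideal R} {x b : R} (hx : RegularMod K x)
    (hb : RegularMod (K ⊔ Ideal.span {x}) b) : RegularMod (K ⊔ Ideal.span {b}) x := by
  intro z hz
  obtain ⟨w, hw⟩ := mem_sup_span_singleton_s2.1 hz
  have h1 : b * w ∈ K ⊔ Ideal.span {x} := mem_sup_span_singleton_s2.2 ⟨z, by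
    have := K.neg_mem hw
    rwa [neg_sub] at this⟩
  obtain ⟨v, hv⟩ := mem_sup_span_singleton_s2.1 (hb _ h1)
  refine mem_sup_span_singleton_s2.2 ⟨v, hx _ ?_⟩
  have : x * (z - b * v) = (x * z - b * w) + b * (w - x * v) := by ring
  rw [this]
  exact K.add_mem hw (K.mul_mem_left _ hv)

theorem eq_maximalIdeal_of_isPrime_of_le [IsLocalRing R] {p : Ideal R} (hp : p.IsPrime)
    (h : maximalIdeal R ≤ p) : p = maximalIdeal R :=
  le_antisymm (IsLocalRing.le_maximalIdeal hp.ne_top) h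

theorem DepthGE.of_isWeaklyRegular [IsLocalRing R] (rs : List R) (hm : ∀ x ∈ rs, x ∈ maximalIdeal R)
    (h : RingTheory.Sequence.IsWeaklyRegular R rs) :
    DepthGE rs.length (⊥ : Ideal R) := by
  suffices H : ∀ n ≤ rs.length, DepthGE n (Ideal.ofList (rs.take (rs.length - n))) by
    simpa using H rs.length le_rfl
  intro n hn
  induction n with
  | zero => trivial
  | succ n ih =>
    have hlt : rs.length - (n + 1) < rs.length := by omega
    have hreg := h.regular_mod_prev _ hlt
    refine ⟨rs[rs.length - (n + 1)], hm _ (List.getElem_mem _), ?_, ?_⟩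
    · intro z hz
      have := hreg.right_eq_zero_of_smul (M := R ⧸ _) (x := Submodule.Quotient.mk z)
      rw [← Submodule.Quotient.mk_smul, Submodule.Quotient.mk_eq_zero,
        Submodule.Quotient.mk_eq_zero] at this
      simp only [smul_eq_mul, Ideal.mul_top] at this
      exact this hz
    · have := ih (by omega)
      have h3 : rs.length - n = rs.length - (n + 1) + 1 := by omega
      rw [h3, List.take_succ_eq_append_getElem hlt, Ideal.ofList_append, Ideal.ofList_singleton]
        at this
      exact this

theorem DepthGE.quotient [IsLocalRing R] {n : ℕ} {a : R} [IsLocalRing (R ⧸ Ideal.span {a})]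
    {K : Ideal (R ⧸ Ideal.span {a})}
    (h : DepthGE n (K.comap (Ideal.Quotient.mk (Ideal.span {a})))) : DepthGE n K := by
  induction n generalizing K with
  | zero => trivial
  | succ n ih =>
    obtain ⟨x, hxm, hx, hd⟩ := h
    have hloc : IsLocalHom (Ideal.Quotient.mk (Ideal.span {a})) :=
      IsLocalHom.of_surjective _ Ideal.Quotient.mk_surjective
    refine ⟨Ideal.Quotient.mk _ x, ?_, ?_, ih ?_⟩
    · rw [mem_maximalIdeal, mem_nonunits_iff, isUnit_map_iff]
      exact hxm
    · intro z hz
      obtain ⟨z, rfl⟩ := Ideal.Quotient.mk_surjective z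
      exact hx z (by rwa [Ideal.mem_comap, map_mul])
    · convert hd using 1
      ext z
      rw [Ideal.mem_comap, mem_sup_span_singleton_s2, mem_sup_span_singleton_s2,
        Ideal.Quotient.mk_surjective.exists]
      simp_rw [← map_mul, ← map_sub, Ideal.mem_comap]

variable [IsNoetherianRing R]

theorem RegularMod.biUnion_associatedPrimes {K : Ideal R} {b : R} :
    RegularMod K b ↔ b ∉ ⋃ p ∈ associatedPrimes R (R ⧸ K), (p : Set R) := by
  rw [biUnion_associatedPrimes_eq_zero_divisors]
  constructor
  · rintro h ⟨y, hy, hby⟩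
    obtain ⟨z, rfl⟩ := Ideal.Quotient.mk_surjective y
    refine hy (Ideal.Quotient.eq_zero_iff_mem.2 (h z (Ideal.Quotient.eq_zero_iff_mem.1 ?_)))
    rw [map_mul]
    exact hby
  · intro h z hz
    by_contra hzK
    refine h ⟨Ideal.Quotient.mk K z, fun h0 => hzK (Ideal.Quotient.eq_zero_iff_mem.1 h0), ?_⟩
    have := Ideal.Quotient.eq_zero_iff_mem.2 hz
    rw [map_mul] at this
    exact this

variable [IsLocalRing R]

theorem RegularMod.of_sup {K : Ideal R} {x b : R} (hxm : x ∈ maximalIdeal R)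
    (hx : RegularMod K x) (hb : RegularMod (K ⊔ Ideal.span {x}) b) : RegularMod K b := by
  let N : Ideal R := K.colon (Ideal.span {b})
  have hN : ∀ z, z ∈ N ↔ b * z ∈ K := fun z => by
    rw [Submodule.mem_colon_span_singleton, smul_eq_mul, mul_comm]
  have hle : N ≤ K := by
    refine Submodule.le_of_le_smul_of_le_jacobson_bot (I := maximalIdeal R)
      (IsNoetherian.noetherian N) (IsLocalRing.maximalIdeal_le_jacobson _) ?_
    intro z hz
    rw [hN] at hz
    obtain ⟨w, hw⟩ := mem_sup_span_singleton_s2.1 (hb z (Ideal.mem_sup_left hz))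
    have hwN : w ∈ N := by
      rw [hN]
      apply hx
      have : x * (b * w) = b * z - b * (z - x * w) := by ring
      rw [this]
      exact K.sub_mem hz (K.mul_mem_left _ hw)
    exact Submodule.mem_sup.2 ⟨_, hw, x * w, Submodule.smul_mem_smul hxm hwN, by ring⟩
  exact fun z hz => hle ((hN z).2 hz)

theorem maximalIdeal_notMem_associatedPrimes {K : Ideal R} {x : R} (hxm : x ∈ maximalIdeal R)
    (hx : RegularMod K x) : maximalIdeal R ∉ associatedPrimes R (R ⧸ K) := fun h =>
  RegularMod.biUnion_associatedPrimes.1 hx (Set.mem_biUnion h hxm)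

theorem maximalIdeal_notMem_associatedPrimes_of_exchange {K : Ideal R} {x a b : R}
    (hxm : x ∈ maximalIdeal R) (hx : RegularMod K x) (ha : RegularMod K a)
    (hbm : b ∈ maximalIdeal R) (hb : RegularMod (K ⊔ Ideal.span {x}) b) :
    maximalIdeal R ∉ associatedPrimes R (R ⧸ (K ⊔ Ideal.span {a})) := by
  intro hass
  rw [AssociatedPrimes.mem_iff, isAssociatedPrime_iff] at hass
  obtain ⟨-, y, hy⟩ := hass
  obtain ⟨z, rfl⟩ := Ideal.Quotient.mk_surjective y
  have hz : ∀ c, c ∈ maximalIdeal R ↔ c * z ∈ K ⊔ Ideal.span {a} := by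
    intro c
    rw [hy, Submodule.mem_colon_singleton, Submodule.mem_bot, ← Ideal.Quotient.eq_zero_iff_mem,
      map_mul]
    rfl
  have hz1 : z ∉ K ⊔ Ideal.span {a} := fun h => by
    have := (hz 1).2 (by rwa [one_mul])
    exact (Ideal.ne_top_iff_one _).1 (maximalIdeal.isMaximal R).ne_top this
  obtain ⟨w, hw⟩ := mem_sup_span_singleton_s2.1 ((hz x).1 hxm)
  obtain ⟨u, hu⟩ := mem_sup_span_singleton_s2.1 ((hz b).1 hbm)
  have h1 : b * w ∈ K ⊔ Ideal.span {x} := by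
    refine mem_sup_span_singleton_s2.2 ⟨u, ha _ ?_⟩
    have : a * (b * w - x * u) = x * (b * z - a * u) - b * (x * z - a * w) := by ring
    rw [this]
    exact K.sub_mem (K.mul_mem_left _ hu) (K.mul_mem_left _ hw)
  obtain ⟨v, hv⟩ := mem_sup_span_singleton_s2.1 (hb _ h1)
  refine hz1 (mem_sup_span_singleton_s2.2 ⟨v, hx _ ?_⟩)
  have : x * (z - a * v) = (x * z - a * w) + a * (w - x * v) := by ring
  rw [this]
  exact K.add_mem hw (K.mul_mem_left _ hv)

theorem exists_regularMod_of_notMem {K L : Ideal R}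
    (hK : maximalIdeal R ∉ associatedPrimes R (R ⧸ K))
    (hL : maximalIdeal R ∉ associatedPrimes R (R ⧸ L)) :
    ∃ b ∈ maximalIdeal R, RegularMod K b ∧ RegularMod L b := by
  by_contra! hcon
  have hfin := (associatedPrimes.finite R (R ⧸ K)).union (associatedPrimes.finite R (R ⧸ L))
  obtain ⟨p, hp, hle⟩ := (Ideal.subset_union_prime_finite hfin (f := fun p => p) 0 0
    (fun p hp _ _ => hp.elim (fun h => h.isPrime) (fun h => h.isPrime))).1
      (show (maximalIdeal R : Set R) ⊆ _ by
        intro b hb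
        rw [Set.biUnion_union]
        by_cases h : RegularMod K b
        · have := hcon b hb h
          rw [RegularMod.biUnion_associatedPrimes, not_not] at this
          exact Or.inr this
        · rw [RegularMod.biUnion_associatedPrimes, not_not] at h
          exact Or.inl h)
  rcases hp with hp | hp
  · exact hK (eq_maximalIdeal_of_isPrime_of_le hp.isPrime hle ▸ hp)
  · exact hL (eq_maximalIdeal_of_isPrime_of_le hp.isPrime hle ▸ hp)

theorem DepthGE.sup_span_singleton {n : ℕ} {K : Ideal R} (h : DepthGE (n + 1) K) {a : R}
    (ham : a ∈ maximalIdeal R) (ha : RegularMod K a) : DepthGE n (K ⊔ Ideal.span {a}) := by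
  induction n generalizing K a with
  | zero => trivial
  | succ n ih =>
    obtain ⟨x, hxm, hx, hd⟩ := h
    have hd' := hd
    obtain ⟨b', hb'm, hb', -⟩ := hd'
    obtain ⟨b, hbm, hbx, hba⟩ := exists_regularMod_of_notMem
      (maximalIdeal_notMem_associatedPrimes hb'm hb')
      (maximalIdeal_notMem_associatedPrimes_of_exchange hxm hx ha hb'm hb')
    have h2 : DepthGE (n + 1) (K ⊔ Ideal.span {b}) := by
      refine ⟨x, hxm, hx.swap hbx, ?_⟩
      rw [sup_right_comm]
      exact ih hd hbm hbx
    refine ⟨b, hbm, hba, ?_⟩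
    rw [sup_right_comm]
    exact ih h2 ham (ha.swap hba)

end Depth

/-- For large `n`, `I ^ (n + 1) : x = I ^ n`. -/
def EventuallyColonEq {R : Type*} [CommRing R] (I : Ideal R) (x : R) : Prop :=
  ∃ N, ∀ n ≥ N, ∀ z, x * z ∈ I ^ (n + 1) → z ∈ I ^ n

section Superficial

variable {R : Type*} [CommRing R]

theorem exists_mem_forall_notMem [IsLocalRing R] [Infinite (ResidueField R)] (J : Ideal R)
    (S : Finset (Ideal R)) (hS : ∀ N ∈ S, ¬ J ≤ N) : ∃ x ∈ J, ∀ N ∈ S, x ∉ N := by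
  classical
  induction S using Finset.induction_on with
  | empty => exact ⟨0, J.zero_mem, by simp⟩
  | insert N S hNS ih =>
    obtain ⟨x, hxJ, hx⟩ := ih fun N' h => hS N' (Finset.mem_insert_of_mem h)
    by_cases hxN : x ∉ N
    · exact ⟨x, hxJ, by simpa [hxN] using hx⟩
    rw [not_not] at hxN
    obtain ⟨y, hyJ, hyN⟩ := SetLike.not_le_iff_exists.1 (hS N (Finset.mem_insert_self _ _))
    let B : Ideal R → Set (ResidueField R) := fun N' => {κ | ∃ c, residue R c = κ ∧ x + c * y ∈ N'}
    have hB : ∀ N' ∈ S, (B N').Subsingleton := by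
      rintro N' hN' _ ⟨c, rfl, hc⟩ _ ⟨c', rfl, hc'⟩
      by_contra hne
      have hu : IsUnit (c - c') := by
        rw [← isUnit_map_iff (residue R), map_sub, isUnit_iff_ne_zero, sub_ne_zero]
        exact hne
      have hy : y ∈ N' := by
        rw [← Ideal.unit_mul_mem_iff_mem N' hu]
        have : (c - c') * y = (x + c * y) - (x + c' * y) := by ring
        rw [this]
        exact N'.sub_mem hc hc'
      exact hx N' hN' ((Submodule.add_mem_iff_left N' (N'.mul_mem_left c hy)).1 hc)
    have hfin : ((⋃ N' ∈ S, B N') ∪ {0}).Finite :=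
      (S.finite_toSet.biUnion fun N' h => (hB N' h).finite).union (Set.finite_singleton 0)
    obtain ⟨κ, hκ⟩ := hfin.exists_notMem
    obtain ⟨c, rfl⟩ := residue_surjective κ
    simp only [Set.mem_union, Set.mem_iUnion, Set.mem_singleton_iff, not_or, not_exists] at hκ
    refine ⟨x + c * y, J.add_mem hxJ (J.mul_mem_left _ hyJ), ?_⟩
    simp only [Finset.mem_insert, forall_eq_or_imp]
    refine ⟨fun h => hyN ?_, fun N' hN' h => hκ.1 N' hN' ⟨c, rfl, h⟩⟩
    have hu : IsUnit c := by
      rw [← isUnit_map_iff (residue R), isUnit_iff_ne_zero]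
      exact hκ.2
    rw [← Ideal.unit_mul_mem_iff_mem N hu]
    exact (Submodule.add_mem_iff_right N hxN).1 h

open Polynomial in
/-- The homogeneous element `z t ^ n` of the Rees algebra. -/
noncomputable def reesMonomial {I : Ideal R} (n : ℕ) (z : R) (hz : z ∈ I ^ n) : reesAlgebra I :=
  ⟨monomial n z, reesAlgebra.monomial_mem.2 hz⟩

theorem reesMonomial_mul {I : Ideal R} {m n : ℕ} {y z : R} (hy : y ∈ I ^ m) (hz : z ∈ I ^ n) :
    reesMonomial m y hy * reesMonomial n z hz =
      reesMonomial (m + n) (y * z) (by rw [pow_add]; exact Ideal.mul_mem_mul hy hz) :=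
  Subtype.ext (Polynomial.monomial_mul_monomial _ _ _ _)

/-- The ideal `I R[It]` of the Rees algebra, with quotient the associated graded ring. -/
def reesIdeal (I : Ideal R) : Ideal (reesAlgebra I) where
  carrier := {f | ∀ i, (f : Polynomial R).coeff i ∈ I ^ (i + 1)}
  add_mem' hf hg i := by
    rw [Subalgebra.coe_add, Polynomial.coeff_add]
    exact Ideal.add_mem _ (hf i) (hg i)
  zero_mem' i := by simp
  smul_mem' g f hf i := by
    rw [smul_eq_mul, Subalgebra.coe_mul, Polynomial.coeff_mul]
    refine Ideal.sum_mem _ ?_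
    rintro ⟨j, k⟩ e
    rw [← Finset.HasAntidiagonal.mem_antidiagonal.mp e, add_assoc, pow_add]
    exact Ideal.mul_mem_mul (g.2 j) (hf k)

theorem reesMonomial_mem_reesIdeal {I : Ideal R} {n : ℕ} {z : R} (hz : z ∈ I ^ n) :
    reesMonomial n z hz ∈ reesIdeal I ↔ z ∈ I ^ (n + 1) := by
  constructor
  · intro h
    simpa [reesMonomial] using h n
  · intro h i
    simp only [reesMonomial, Polynomial.coeff_monomial]
    split_ifs with hi
    · exact hi ▸ h
    · exact zero_mem _

/-- The elements `x` of `I` such that `x t` lies in the ideal `P` of the Rees algebra. -/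
noncomputable def degreeOnePart {I : Ideal R} (P : Ideal (reesAlgebra I)) : Ideal R where
  carrier := {x | ∃ hx : x ∈ I ^ 1, reesMonomial 1 x hx ∈ P}
  add_mem' := by
    rintro x y ⟨hx, hxP⟩ ⟨hy, hyP⟩
    refine ⟨Ideal.add_mem _ hx hy, ?_⟩
    convert P.add_mem hxP hyP using 1
    exact Subtype.ext (map_add (Polynomial.monomial 1) _ _)
  zero_mem' := ⟨zero_mem _, by
    convert P.zero_mem using 1
    exact Subtype.ext (map_zero (Polynomial.monomial 1))⟩
  smul_mem' := by
    rintro c x ⟨hx, hxP⟩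
    refine ⟨Ideal.mul_mem_left _ _ hx, ?_⟩
    convert P.mul_mem_left (algebraMap R _ c) hxP using 1
    refine Subtype.ext ?_
    simp [reesMonomial, Polynomial.C_mul_monomial]

theorem reesMonomial_mem_pow {I : Ideal R} {P : Ideal (reesAlgebra I)}
    (h : I ≤ degreeOnePart P) {n : ℕ} {z : R} (hz : z ∈ I ^ n) : reesMonomial n z hz ∈ P ^ n := by
  induction n generalizing z with
  | zero => simp
  | succ n ih =>
    have hz' := hz
    rw [pow_succ] at hz'
    induction hz' using Submodule.mul_induction_on' with
    | mem_mul_mem a ha b hb =>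
      obtain ⟨hb1, hbP⟩ := h hb
      have := Ideal.mul_mem_mul (ih ha) hbP
      rwa [reesMonomial_mul, ← pow_succ] at this
    | add a ha b hb iha ihb =>
      rw [← pow_succ] at ha hb
      convert (P ^ (n + 1)).add_mem (iha ha) (ihb hb) using 1
      exact Subtype.ext (map_add (Polynomial.monomial (n + 1)) _ _)

theorem le_degreeOnePart_of_reduction {I J : Ideal R} {r : ℕ} (hr : I ^ (r + 1) = J * I ^ r)
    {P : Ideal (reesAlgebra I)} (hP : P.IsPrime) (h : J ≤ degreeOnePart P) :
    I ≤ degreeOnePart P := by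
  have key : ∀ z (hz : z ∈ I ^ (r + 1)), reesMonomial (r + 1) z hz ∈ P := by
    intro z hz
    have hz' := hz
    rw [hr, mul_comm] at hz'
    induction hz' using Submodule.mul_induction_on' with
    | mem_mul_mem a ha b hb =>
      obtain ⟨hb1, hbP⟩ := h hb
      have := P.mul_mem_left (reesMonomial r a ha) hbP
      rwa [reesMonomial_mul] at this
    | add a ha b hb iha ihb =>
      rw [mul_comm, ← hr] at ha hb
      convert P.add_mem (iha ha) (ihb hb) using 1
      exact Subtype.ext (map_add (Polynomial.monomial (r + 1)) _ _)
  intro x hx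
  have hx1 : x ∈ I ^ 1 := by rwa [pow_one]
  refine ⟨hx1, hP.mem_of_pow_mem (r + 1) ?_⟩
  convert key (x ^ (r + 1)) (Ideal.pow_mem_pow hx _) using 1
  refine Subtype.ext ?_
  simp [reesMonomial, Polynomial.monomial_pow]

theorem exists_colon_inf_eq [IsNoetherianRing R] [IsLocalRing R] [Infinite (ResidueField R)]
    {I J : Ideal R} (hJI : J ≤ I) {r : ℕ} (hr : I ^ (r + 1) = J * I ^ r)
    (S : Finset (Ideal R)) (hS : ∀ N ∈ S, ¬ J ≤ N) :
    ∃ x ∈ J, (∀ N ∈ S, x ∉ N) ∧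
      ∃ c, ∀ n ≥ c, ∀ z ∈ I ^ n, x * z ∈ I ^ (n + 2) → z ∈ I ^ (n + 1) := by
  classical
  obtain ⟨s, hs, hprim⟩ : ∃ s : Finset (Ideal (reesAlgebra I)),
      s.inf id = reesIdeal I ∧ ∀ ⦃Q⦄, Q ∈ s → Q.IsPrimary :=
    Submodule.isLasker (reesAlgebra I) (reesAlgebra I) (reesIdeal I)
  let T : Finset (Ideal R) := ((s.image Ideal.radical).image degreeOnePart).filter (¬ J ≤ ·)
  obtain ⟨x, hxJ, hx⟩ := exists_mem_forall_notMem J (S ∪ T) fun N hN =>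
    (Finset.mem_union.1 hN).elim (hS N) fun h => (Finset.mem_filter.1 h).2
  have hc : ∀ Q : Ideal (reesAlgebra I), ∃ c, Q ∈ s → J ≤ degreeOnePart Q.radical →
      Q.radical ^ c ≤ Q := by
    intro Q
    obtain ⟨c, hc⟩ := Ideal.exists_radical_pow_le_of_fg Q (IsNoetherian.noetherian _)
    exact ⟨c, fun _ _ => hc⟩
  choose c hc using hc
  refine ⟨x, hxJ, fun N hN => hx N (Finset.mem_union_left _ hN), s.sup c, ?_⟩
  intro n hn z hz hxz
  rw [← reesMonomial_mem_reesIdeal hz, ← hs, Submodule.mem_finsetInf]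
  intro (Q : Ideal (reesAlgebra I)) hQ
  rw [id]
  have hx1 : x ∈ I ^ 1 := by rw [pow_one]; exact hJI hxJ
  by_cases hJQ : J ≤ degreeOnePart Q.radical
  · have hprime := Ideal.isPrime_radical (hprim hQ)
    refine hc Q hQ hJQ (Ideal.pow_le_pow_right ((Finset.le_sup hQ).trans hn)
      (reesMonomial_mem_pow (le_degreeOnePart_of_reduction hr hprime hJQ) hz))
  · have hxQ : reesMonomial 1 x hx1 ∉ Q.radical := fun h =>
      hx (degreeOnePart Q.radical) (Finset.mem_union_right _ (Finset.mem_filter.2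
        ⟨Finset.mem_image_of_mem _ (Finset.mem_image_of_mem _ hQ), hJQ⟩)) ⟨hx1, h⟩
    have hmem : reesMonomial 1 x hx1 * reesMonomial n z hz ∈ Q := by
      have : reesMonomial 1 x hx1 * reesMonomial n z hz ∈ reesIdeal I := by
        rw [reesMonomial_mul, reesMonomial_mem_reesIdeal]
        rwa [add_assoc, add_comm 1, add_assoc]
      rw [← hs, Submodule.mem_finsetInf] at this
      exact this Q hQ
    rw [mul_comm] at hmem
    exact ((Ideal.isPrimary_iff.1 (hprim hQ)).2 hmem).resolve_right hxQ

theorem eventuallyColonEq_of_colon_inf [IsNoetherianRing R] {I : Ideal R} {x : R}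
    (hx : RegularMod ⊥ x) {c : ℕ}
    (hc : ∀ n ≥ c, ∀ z ∈ I ^ n, x * z ∈ I ^ (n + 2) → z ∈ I ^ (n + 1)) :
    EventuallyColonEq I x := by
  have hreg : ∀ {y z : R}, x * y = x * z → y = z := fun {y z} h => by
    have := hx (y - z) (by rw [Ideal.mem_bot, mul_sub, h, sub_self])
    rwa [Ideal.mem_bot, sub_eq_zero] at this
  have key : ∀ n ≥ c, ∀ z ∈ I ^ c, x * z ∈ I ^ (n + 1) → z ∈ I ^ n := by
    intro n hn
    induction n, hn using Nat.le_induction with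
    | base => exact fun z hz _ => hz
    | succ n hn ih =>
      intro z hz hxz
      exact hc n hn z (ih z hz (Ideal.pow_le_pow_right (by omega) hxz)) hxz
  obtain ⟨k, hk⟩ := Ideal.exists_pow_inf_eq_pow_smul I (Ideal.span {x})
  refine ⟨c + k, fun n hn z hz => key n (by omega) z ?_ hz⟩
  have h1 : x * z ∈ (I ^ (n + 1) • ⊤ ⊓ Ideal.span {x} : Ideal R) := by
    refine ⟨by simpa using hz, Ideal.mul_mem_right _ _ (Ideal.mem_span_singleton_self x)⟩
  rw [hk (n + 1) (by omega)] at h1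
  have h2 := Ideal.mul_mono_right (I := I ^ (n + 1 - k))
    (inf_le_right : (I ^ k • ⊤ ⊓ Ideal.span {x} : Ideal R) ≤ _) h1
  rw [Ideal.mem_mul_span_singleton] at h2
  obtain ⟨w, hw, hwz⟩ := h2
  rw [mul_comm] at hwz
  exact hreg hwz ▸ Ideal.pow_le_pow_right (by omega) hw

end Superficial

/-- `J` is generated by a superficial regular sequence of length `n` for `I`, modulo which some
power of `I` vanishes. -/
def SuperficialReduction : ℕ → ∀ (R : Type u) [CommRing R], Ideal R → Ideal R → Prop
  | 0, _, _, I, J => J = ⊥ ∧ ∃ n, I ^ n = ⊥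
  | n + 1, R, _, I, J => ∃ x ∈ J, x ∈ I ∧ RegularMod ⊥ x ∧ EventuallyColonEq I x ∧
      SuperficialReduction n (R ⧸ Ideal.span {x}) (I.map (Ideal.Quotient.mk _))
        (J.map (Ideal.Quotient.mk _))

section SuperficialReduction

variable {R : Type u} [CommRing R]

theorem comap_map_mk_of_mem {J : Ideal R} {x : R} (hx : x ∈ J) :
    (J.map (Ideal.Quotient.mk (Ideal.span {x}))).comap (Ideal.Quotient.mk _) = J := by
  rw [Ideal.comap_map_of_surjective _ Ideal.Quotient.mk_surjective, ← RingHom.ker_eq_comap_bot,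
    Ideal.mk_ker, sup_eq_left, Ideal.span_singleton_le_iff_mem]
  exact hx

theorem comap_map_mk_span_singleton (J : Ideal R) (x : R) :
    (J.map (Ideal.Quotient.mk (Ideal.span {x}))).comap (Ideal.Quotient.mk _) =
      J ⊔ Ideal.span {x} := by
  rw [Ideal.comap_map_of_surjective _ Ideal.Quotient.mk_surjective, ← RingHom.ker_eq_comap_bot,
    Ideal.mk_ker]

theorem SuperficialReduction.le {n : ℕ} {I J : Ideal R} (h : SuperficialReduction n R I J) :
    J ≤ I := by
  induction n generalizing R with
  | zero => exact h.1 ▸ bot_le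
  | succ n ih =>
    obtain ⟨x, hxJ, hxI, -, -, h⟩ := h
    have := Ideal.comap_mono (f := Ideal.Quotient.mk (Ideal.span {x})) (ih h)
    rwa [comap_map_mk_of_mem hxJ, comap_map_mk_of_mem hxI] at this

theorem pow_succ_le_mul_pow_of_map {I J : Ideal R} {x : R} {n : ℕ} (hJI : J ≤ I) (hxJ : x ∈ J)
    (hcolon : ∀ z, x * z ∈ I ^ (n + 1) → z ∈ I ^ n)
    (h : (I.map (Ideal.Quotient.mk (Ideal.span {x}))) ^ (n + 1) =
      J.map (Ideal.Quotient.mk _) * (I.map (Ideal.Quotient.mk _)) ^ n) :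
    I ^ (n + 1) = J * I ^ n := by
  refine le_antisymm ?_ ((Ideal.mul_mono_left hJI).trans (pow_succ' I n).ge)
  intro z hz
  rw [← Ideal.map_pow, ← Ideal.map_pow, ← Ideal.map_mul] at h
  have h2 := congrArg (Ideal.comap (Ideal.Quotient.mk (Ideal.span {x}))) h
  rw [comap_map_mk_span_singleton, comap_map_mk_span_singleton] at h2
  have hz' : z ∈ J * I ^ n ⊔ Ideal.span {x} := h2 ▸ Ideal.mem_sup_left hz
  obtain ⟨w, hw⟩ := mem_sup_span_singleton_s2.1 hz'
  have hle : J * I ^ n ≤ I ^ (n + 1) := (Ideal.mul_mono_left hJI).trans (pow_succ' I n).ge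
  have hxw : x * w ∈ I ^ (n + 1) := by
    have := (I ^ (n + 1)).sub_mem hz (hle hw)
    rwa [sub_sub_cancel] at this
  have := Ideal.add_mem _ hw (Ideal.mul_mem_mul hxJ (hcolon w hxw))
  rwa [sub_add_cancel] at this

theorem SuperficialReduction.exists_pow_succ_eq {d : ℕ} {I J : Ideal R}
    (h : SuperficialReduction d R I J) : ∃ N, ∀ n ≥ N, I ^ (n + 1) = J * I ^ n := by
  induction d generalizing R with
  | zero =>
    obtain ⟨rfl, N, hN⟩ := h
    refine ⟨N, fun n hn => ?_⟩
    rw [Ideal.bot_mul, eq_bot_iff, ← hN]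
    exact Ideal.pow_le_pow_right (by omega)
  | succ d ih =>
    have hle := h.le
    obtain ⟨x, hxJ, hxI, -, ⟨N, hN⟩, h⟩ := h
    obtain ⟨N', hN'⟩ := ih h
    exact ⟨max N N', fun n hn => pow_succ_le_mul_pow_of_map hle hxJ
      (hN n (le_of_max_le_left hn)) (hN' n (le_of_max_le_right hn))⟩

theorem SuperficialReduction.isReduction {d : ℕ} {I J : Ideal R}
    (h : SuperficialReduction d R I J) : IsReduction J I :=
  let ⟨N, hN⟩ := h.exists_pow_succ_eq
  ⟨h.le, N, hN N le_rfl⟩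

theorem IsReduction.exists_superficialReduction [IsNoetherianRing R] [IsLocalRing R]
    [Infinite (ResidueField R)] {d : ℕ} (hdim : ringKrullDim R ≤ d)
    (hdepth : DepthGE d (⊥ : Ideal R)) {I J : Ideal R} (hIm : I ≤ maximalIdeal R) {k : ℕ}
    (hmI : maximalIdeal R ^ k ≤ I) (hJ : IsReduction J I) :
    ∃ J' ≤ J, SuperficialReduction d R I J' := by
  induction d generalizing R k with
  | zero =>
    refine ⟨⊥, bot_le, rfl, ?_⟩
    have : Ring.KrullDimLE 0 R := Ring.krullDimLE_iff.2 hdim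
    have hart : IsArtinianRing R := isArtinianRing_iff_isNoetherianRing_krullDimLE_zero.2
      ⟨inferInstance, this⟩
    obtain ⟨n, hn⟩ := IsArtinianRing.isNilpotent_jacobson_bot (R := R)
    refine ⟨n, eq_bot_iff.2 ?_⟩
    rw [IsLocalRing.jacobson_eq_maximalIdeal _ bot_ne_top] at hn
    exact (Ideal.pow_right_mono hIm n).trans hn.le
  | succ d ih =>
    obtain ⟨hJI, r, hr⟩ := hJ
    have hdepth' := hdepth
    obtain ⟨a, ham, ha, -⟩ := hdepth'
    have hass := maximalIdeal_notMem_associatedPrimes ham ha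
    let S : Finset (Ideal R) := (associatedPrimes.finite R (R ⧸ (⊥ : Ideal R))).toFinset
    have hS : ∀ p ∈ S, ¬ J ≤ p := by
      intro p hp hle
      rw [Set.Finite.mem_toFinset] at hp
      have hprime : p.IsPrime := hp.isPrime
      have h1 : I ≤ p := hprime.le_of_pow_le (n := r + 1)
        (hr ▸ Ideal.mul_le_left.trans hle)
      exact hass (eq_maximalIdeal_of_isPrime_of_le hprime
        (hprime.le_of_pow_le (hmI.trans h1)) ▸ hp)
    obtain ⟨x, hxJ, hxS, c, hc⟩ := exists_colon_inf_eq hJI hr S hS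
    have hreg : RegularMod ⊥ x := by
      rw [RegularMod.biUnion_associatedPrimes]
      simpa [S] using hxS
    have hxm : x ∈ maximalIdeal R := hIm (hJI hxJ)
    have hne : Ideal.span {x} ≠ ⊤ := fun h => (Ideal.IsPrime.ne_top' : maximalIdeal R ≠ ⊤)
      (top_le_iff.1 (h ▸ (Ideal.span_singleton_le_iff_mem _).2 hxm))
    have : Nontrivial (R ⧸ Ideal.span {x}) := Ideal.Quotient.nontrivial_iff.2 hne
    have : IsLocalRing (R ⧸ Ideal.span {x}) :=
      IsLocalRing.of_surjective' _ Ideal.Quotient.mk_surjective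
    have hloc : IsLocalHom (Ideal.Quotient.mk (Ideal.span {x})) :=
      IsLocalHom.of_surjective _ Ideal.Quotient.mk_surjective
    have : Infinite (ResidueField (R ⧸ Ideal.span {x})) :=
      Infinite.of_injective _ (ResidueField.map (Ideal.Quotient.mk (Ideal.span {x}))).injective
    have hmap : (maximalIdeal R).map (Ideal.Quotient.mk (Ideal.span {x})) =
        maximalIdeal (R ⧸ Ideal.span {x}) :=
      IsLocalRing.map_maximalIdeal_of_surjective _ Ideal.Quotient.mk_surjective
    obtain ⟨J', hJ', hgood⟩ := ih (R := R ⧸ Ideal.span {x}) (k := k)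
      (I := I.map (Ideal.Quotient.mk _)) (J := J.map (Ideal.Quotient.mk _))
      (by
        have h1 := ringKrullDim_quotient_succ_le_of_nonZeroDivisor (r := x) (by
          rw [mem_nonZeroDivisors_iff_left]
          exact fun z hz => hreg z hz)
        have := h1.trans hdim
        rw [Nat.cast_add, Nat.cast_one] at this
        exact ENat.WithBot.add_le_add_one_right_iff.1 this)
      (by
        refine DepthGE.quotient ?_
        have := hdepth.sup_span_singleton hxm hreg
        rwa [bot_sup_eq, ← Ideal.mk_ker (I := Ideal.span {x}), RingHom.ker_eq_comap_bot] at this)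
      (hmap ▸ Ideal.map_mono hIm)
      (by rw [← hmap, ← Ideal.map_pow]; exact Ideal.map_mono hmI)
      ⟨Ideal.map_mono hJI, r, by rw [← Ideal.map_pow, hr, Ideal.map_mul, Ideal.map_pow]⟩
    refine ⟨J'.comap (Ideal.Quotient.mk _), ?_, x, ?_, hJI hxJ, hreg,
      eventuallyColonEq_of_colon_inf hreg hc, ?_⟩
    · have := Ideal.comap_mono (f := Ideal.Quotient.mk (Ideal.span {x})) hJ'
      rwa [comap_map_mk_of_mem hxJ] at this
    · rw [Ideal.mem_comap, Ideal.Quotient.eq_zero_iff_mem.2 (Ideal.mem_span_singleton_self x)]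
      exact zero_mem _
    · rwa [Ideal.map_comap_of_surjective _ Ideal.Quotient.mk_surjective]

end SuperficialReduction

/-- The quotient `R ⧸ K` has finite length. -/
def FiniteColength {R : Type*} [CommRing R] (K : Ideal R) : Prop :=
  Module.length R (R ⧸ K) ≠ ⊤

/-- The length of `R ⧸ K`, or `0` when it is infinite. -/
noncomputable def colength {R : Type*} [CommRing R] (K : Ideal R) : ℕ :=
  (Module.length R (R ⧸ K)).toNat

section Colength

variable {R : Type*} [CommRing R] {K L : Ideal R}

theorem FiniteColength.coe_colength (h : FiniteColength K) :
    (colength K : ℕ∞) = Module.length R (R ⧸ K) :=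
  ENat.natCast_toNat h

theorem moduleLength_eq_natCast_iff {l : ℕ} :
    moduleLength R (R ⧸ K) = (l : WithBot ℕ∞) ↔ FiniteColength K ∧ colength K = l := by
  rw [moduleLength, ← Module.coe_length]
  constructor
  · intro h
    have h' : Module.length R (R ⧸ K) = l := WithBot.coe_injective h
    exact ⟨by rw [FiniteColength, h']; exact ENat.natCast_ne_top l, by rw [colength, h']; rfl⟩
  · rintro ⟨h, rfl⟩
    rw [← h.coe_colength]
    rfl

theorem length_quotient_le (h : K ≤ L) : Module.length R (R ⧸ L) ≤ Module.length R (R ⧸ K) :=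
  Module.length_le_of_surjective (Submodule.factor h) (Submodule.factor_surjective h)

theorem FiniteColength.mono (hK : FiniteColength K) (h : K ≤ L) : FiniteColength L :=
  ne_top_of_le_ne_top hK (length_quotient_le h)

theorem FiniteColength.colength_le (hK : FiniteColength K) (h : K ≤ L) :
    colength L ≤ colength K :=
  ENat.toNat_le_toNat (length_quotient_le h) hK

theorem colength_top : colength (⊤ : Ideal R) = 0 := by
  rw [colength, Module.length_eq_zero, ENat.toNat_zero]

theorem FiniteColength.eq_top_of_colength_eq_zero (hK : FiniteColength K) (h : colength K = 0) :
    K = ⊤ := by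
  have h' := hK.coe_colength
  rw [h, Nat.cast_zero, eq_comm, Module.length_eq_zero_iff] at h'
  exact Ideal.Quotient.subsingleton_iff.1 h'

theorem FiniteColength.colength_eq_add (hK : FiniteColength K) {x : R}
    (hL : ∀ z, z ∈ L ↔ x * z ∈ K) :
    colength K = colength L + colength (K ⊔ Ideal.span {x}) := by
  have hKL : K ≤ L := fun z hz => (hL z).2 (K.mul_mem_left x hz)
  let f : (R ⧸ L) →ₗ[R] (R ⧸ K) := Submodule.mapQ L K (LinearMap.mulLeft R x)
    fun z hz => (hL z).1 hz
  let g : (R ⧸ K) →ₗ[R] (R ⧸ (K ⊔ Ideal.span {x})) := Submodule.factor le_sup_left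
  have hf : Function.Injective f := by
    rw [injective_iff_map_eq_zero]
    intro z hz
    obtain ⟨z, rfl⟩ := Submodule.mkQ_surjective L z
    exact (Submodule.Quotient.mk_eq_zero L).2
      ((hL z).2 ((Submodule.Quotient.mk_eq_zero K).1 hz))
  have hg : Function.Surjective g := Submodule.factor_surjective _
  have hfg : Function.Exact f g := by
    intro z
    obtain ⟨z, rfl⟩ := Submodule.mkQ_surjective K z
    constructor
    · intro hz
      obtain ⟨w, hw⟩ := mem_sup_span_singleton_s2.1 ((Submodule.Quotient.mk_eq_zero _).1 hz)
      refine ⟨Submodule.mkQ L w, ?_⟩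
      rw [eq_comm, ← sub_eq_zero]
      exact (Submodule.Quotient.mk_eq_zero K).2 hw
    · rintro ⟨w, hw⟩
      obtain ⟨w, rfl⟩ := Submodule.mkQ_surjective L w
      rw [← hw]
      exact (Submodule.Quotient.mk_eq_zero _).2
        (Ideal.mem_sup_right (Ideal.mul_mem_right w _ (Ideal.mem_span_singleton_self x)))
  have h := Module.length_eq_add_of_exact f g hf hg hfg
  rw [← hK.coe_colength, ← (hK.mono hKL).coe_colength,
    ← (hK.mono le_sup_left).coe_colength] at h
  exact_mod_cast h

theorem FiniteColength.eq_of_colength_le (hK : FiniteColength K) (h : K ≤ L)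
    (hle : colength K ≤ colength L) : K = L := by
  refine le_antisymm h fun z hz => ?_
  have hcol : ∀ w, w ∈ K.colon (Ideal.span {z}) ↔ z * w ∈ K := fun w => by
    rw [Submodule.mem_colon_span_singleton, smul_eq_mul, mul_comm]
  have h1 := hK.colength_eq_add hcol
  have h2 : colength L ≤ colength (K ⊔ Ideal.span {z}) :=
    (hK.mono le_sup_left).colength_le (sup_le h ((Ideal.span_singleton_le_iff_mem _).2 hz))
  have h3 : K.colon (Ideal.span {z}) = ⊤ := FiniteColength.eq_top_of_colength_eq_zero
    (hK.mono fun w hw => (hcol w).2 (K.mul_mem_left z hw)) (by omega)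
  have h4 := (hcol 1).1 (h3 ▸ Submodule.mem_top)
  rwa [mul_one] at h4

theorem colength_span_singleton_mul {x : R} (hx : RegularMod ⊥ x)
    (hK : FiniteColength (Ideal.span {x} * K)) :
    colength (Ideal.span {x} * K) = colength K + colength (Ideal.span {x}) := by
  have h := hK.colength_eq_add (x := x) (L := K) fun z => by
    rw [Ideal.mem_span_singleton_mul]
    refine ⟨fun hz => ⟨z, hz, rfl⟩, ?_⟩
    rintro ⟨w, hw, hwz⟩
    have := hx (w - z) (by rw [Ideal.mem_bot, mul_sub, hwz, sub_self])
    rw [Ideal.mem_bot, sub_eq_zero] at this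
    exact this ▸ hw
  rwa [sup_eq_right.2 Ideal.mul_le_left] at h

theorem length_quotient_comap_mk {x : R} (K : Ideal (R ⧸ Ideal.span {x})) :
    Module.length R (R ⧸ K.comap (Ideal.Quotient.mk (Ideal.span {x}))) =
      Module.length (R ⧸ Ideal.span {x}) ((R ⧸ Ideal.span {x}) ⧸ K) := by
  rw [← Module.length_eq_of_surjective (S := R) (R := R ⧸ Ideal.span {x})
    Ideal.Quotient.mk_surjective]
  let f : R →ₗ[R] (R ⧸ Ideal.span {x}) ⧸ K := Algebra.linearMap R _
  have hf : Function.Surjective f :=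
    Ideal.Quotient.mk_surjective.comp Ideal.Quotient.mk_surjective
  have hker : K.comap (Ideal.Quotient.mk (Ideal.span {x})) = LinearMap.ker f := by
    ext z
    rw [LinearMap.mem_ker, Ideal.mem_comap]
    exact Ideal.Quotient.eq_zero_iff_mem.symm
  rw [hker]
  exact (f.quotKerEquivOfSurjective hf).length_eq

theorem finiteColength_comap_mk {x : R} {K : Ideal (R ⧸ Ideal.span {x})} :
    FiniteColength (K.comap (Ideal.Quotient.mk (Ideal.span {x}))) ↔ FiniteColength K := by
  rw [FiniteColength, FiniteColength, length_quotient_comap_mk]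

theorem colength_comap_mk {x : R} (K : Ideal (R ⧸ Ideal.span {x})) :
    colength (K.comap (Ideal.Quotient.mk (Ideal.span {x}))) = colength K := by
  rw [colength, colength, length_quotient_comap_mk]

end Colength

section Hilbert

variable {R : Type u} [CommRing R] {I J : Ideal R} {e : ℕ → ℤ}

theorem hasHilbertCoeffs_iff {d : ℕ} : HasHilbertCoeffs I d e ↔
    ∃ N : ℕ, ∀ n ≥ N, FiniteColength (I ^ (n + 1)) ∧ (colength (I ^ (n + 1)) : ℤ) =
      ∑ i ∈ Finset.range (d + 1), (-1 : ℤ) ^ i * e i * ((n + d - i).choose (d - i)) := by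
  simp only [HasHilbertCoeffs, moduleLength_eq_natCast_iff]
  refine exists_congr fun N => forall₂_congr fun n _ => ⟨?_, fun h => ⟨_, ⟨h.1, rfl⟩, h.2⟩⟩
  rintro ⟨l, ⟨hf, rfl⟩, hl⟩
  exact ⟨hf, hl⟩

theorem HasHilbertCoeffs.finiteColength_pow {d : ℕ} (h : HasHilbertCoeffs I d e) (n : ℕ) :
    FiniteColength (I ^ n) := by
  obtain ⟨N, hN⟩ := hasHilbertCoeffs_iff.1 h
  exact (hN (max N n) (le_max_left _ _)).1.mono
    (Ideal.pow_le_pow_right ((le_max_right N n).trans (Nat.le_succ _)))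

theorem HasHilbertCoeffs.map {d : ℕ} (h : HasHilbertCoeffs I (d + 1) e) {x : R} (hxI : x ∈ I)
    (hx : EventuallyColonEq I x) :
    HasHilbertCoeffs (I.map (Ideal.Quotient.mk (Ideal.span {x}))) d e := by
  obtain ⟨N, hN⟩ := hasHilbertCoeffs_iff.1 h
  obtain ⟨N', hN'⟩ := hx
  refine hasHilbertCoeffs_iff.2 ⟨max N N' + 1, fun n hn => ?_⟩
  obtain ⟨m, rfl⟩ : ∃ m, n = m + 1 := ⟨n - 1, by omega⟩
  rw [← Ideal.map_pow, ← finiteColength_comap_mk, ← colength_comap_mk,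
    comap_map_mk_span_singleton]
  obtain ⟨hf, h1⟩ := hN (m + 1) (by omega)
  obtain ⟨-, h0⟩ := hN m (by omega)
  refine ⟨hf.mono le_sup_left, ?_⟩
  have h2 := hf.colength_eq_add (x := x) (L := I ^ (m + 1)) fun z => ⟨fun hz => by
    rw [pow_succ']
    exact Ideal.mul_mem_mul hxI hz, hN' (m + 1) (by omega) z⟩
  have h3 : (colength (I ^ (m + 1 + 1) ⊔ Ideal.span {x}) : ℤ) =
      colength (I ^ (m + 1 + 1)) - colength (I ^ (m + 1)) := by
    rw [h2]
    push_cast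
    ring
  rw [h3, h1, h0, ← Finset.sum_sub_distrib, Finset.sum_range_succ]
  rw [Nat.sub_self, Nat.choose_zero_right, Nat.choose_zero_right, sub_self, add_zero]
  refine Finset.sum_congr rfl fun i hi => ?_
  obtain ⟨k, rfl⟩ : ∃ k, d = i + k := ⟨d - i, by have := Finset.mem_range.1 hi; omega⟩
  have e1 : m + 1 + (i + k + 1) - i = m + 1 + k + 1 := by omega
  have e2 : m + (i + k + 1) - i = m + 1 + k := by omega
  have e3 : i + k + 1 - i = k + 1 := by omega
  have e4 : m + 1 + (i + k) - i = m + 1 + k := by omega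
  have e5 : i + k - i = k := by omega
  rw [e1, e2, e3, e4, e5, Nat.choose_succ_succ]
  push_cast
  ring

theorem SuperficialReduction.colength_eq {d : ℕ} (hJ : SuperficialReduction d R I J)
    (h : HasHilbertCoeffs I d e) : FiniteColength J ∧ (colength J : ℤ) = e 0 := by
  induction d generalizing R with
  | zero =>
    obtain ⟨rfl, n, hn⟩ := hJ
    obtain ⟨N, hN⟩ := hasHilbertCoeffs_iff.1 h
    have hle : I ^ (max N n + 1) = ⊥ := by
      rw [eq_bot_iff, ← hn]
      exact Ideal.pow_le_pow_right ((le_max_right N n).trans (Nat.le_succ _))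
    have := hN (max N n) (le_max_left _ _)
    rw [hle] at this
    simpa using this
  | succ d ih =>
    obtain ⟨x, hxJ, hxI, -, hx, hJ⟩ := hJ
    have := ih hJ (h.map hxI hx)
    rwa [← finiteColength_comap_mk, ← colength_comap_mk, comap_map_mk_of_mem hxJ] at this

theorem SuperficialReduction.pow_three_eq_of_dim_one (hJ : SuperficialReduction 1 R I J)
    (h : HasHilbertCoeffs I 1 e) (h1 : e 0 - e 1 = colength I - 1) :
    I ^ 2 ≠ J * I ∧ I ^ 3 = J * I ^ 2 := by
  obtain ⟨-, hE⟩ := hJ.colength_eq h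
  obtain ⟨M, hM⟩ := hJ.exists_pow_succ_eq
  obtain ⟨x, hxJ, hxI, hx, -, hJx, -⟩ := hJ
  have hJ' : J = Ideal.span {x} := by
    rw [← comap_map_mk_of_mem hxJ, hJx, ← RingHom.ker_eq_comap_bot, Ideal.mk_ker]
  obtain ⟨N, hN⟩ := hasHilbertCoeffs_iff.1 h
  have hJI : J ≤ I := by rwa [hJ', Ideal.span_singleton_le_iff_mem]
  have hle : ∀ n, J * I ^ n ≤ I ^ (n + 1) := fun n => by
    rw [pow_succ']
    exact Ideal.mul_mono_left hJI
  have hfin : ∀ n, FiniteColength (J * I ^ n) := fun n =>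
    ((h.finiteColength_pow (max M n + 1)).mono (hM (max M n) (le_max_left _ _)).le).mono
      (Ideal.mul_mono_right (Ideal.pow_le_pow_right (le_max_right _ _)))
  have hcol : ∀ n, colength (J * I ^ n) = colength (I ^ n) + colength J := fun n => by
    have := hfin n
    rw [hJ'] at this ⊢
    exact colength_span_singleton_mul hx this
  let v : ℕ → ℤ := fun n => colength J + colength (I ^ (n + 1)) - colength (I ^ (n + 1 + 1))
  have hv : ∀ n, 0 ≤ v n := fun n => by
    have := (hfin (n + 1)).colength_le (hle (n + 1))
    rw [hcol (n + 1)] at this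
    simp only [v]
    omega
  have hv0 : ∀ n, v n = 0 ↔ I ^ (n + 1 + 1) = J * I ^ (n + 1) := fun n => by
    constructor
    · intro h0
      refine ((hfin (n + 1)).eq_of_colength_le (hle (n + 1)) ?_).symm
      rw [hcol (n + 1)]
      simp only [v] at h0
      omega
    · intro h0
      simp only [v]
      rw [h0, hcol (n + 1)]
      push_cast
      ring
  have hsum : ∀ n, ∑ i ∈ Finset.range n, v i =
      n * colength J + colength I - colength (I ^ (n + 1)) := fun n => by
    induction n with
    | zero => simp
    | succ n ih =>
      rw [Finset.sum_range_succ, ih]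
      simp only [v]
      push_cast
      ring
  have hsum1 : ∑ i ∈ Finset.range (N + 2), v i = 1 := by
    rw [hsum, (hN (N + 2) (by omega)).2, hE, Finset.sum_range_succ, Finset.sum_range_one]
    simp
    linarith
  have hne : I ^ 2 ≠ J * I := by
    intro hI2
    have hstep : ∀ n, I ^ (n + 2) = J * I ^ (n + 1) := fun n => by
      rw [pow_add, hI2, pow_succ]
      ring
    rw [Finset.sum_eq_zero fun i _ => (hv0 i).2 (hstep i)] at hsum1
    exact zero_ne_one hsum1
  refine ⟨hne, (hv0 1).1 ?_⟩
  have hpos : 0 < v 0 := (hv 0).lt_of_ne fun h0 => hne (by simpa using (hv0 0).1 h0.symm)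
  rw [Finset.sum_range_succ', Finset.sum_range_succ'] at hsum1
  have := Finset.sum_nonneg fun i (_ : i ∈ Finset.range N) => hv (i + 1 + 1)
  have := hv 1
  simp only [zero_add] at hsum1
  omega

end Hilbert

section DimensionTwo

theorem sum_defect_formula {E : ℤ} {h g : ℕ → ℤ} (h0 : h 0 = 0) (g0 : g 0 = 0)
    (hg : ∀ n, h (n + 1) = h n + g (n + 1)) (n : ℕ) :
    g n = n * E - ∑ i ∈ Finset.range n, (E + g i - g (i + 1)) ∧
    h n = E * (n + 1).choose 2 - n * ∑ i ∈ Finset.range n, (E + g i - g (i + 1)) +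
      ∑ i ∈ Finset.range n, i * (E + g i - g (i + 1)) := by
  induction n with
  | zero => simp [h0, g0]
  | succ n ih =>
    have hg' : g (n + 1) = (n + 1 : ℕ) * E -
        ∑ i ∈ Finset.range (n + 1), (E + g i - g (i + 1)) := by
      rw [Finset.sum_range_succ]
      push_cast
      linear_combination ih.1
    refine ⟨hg', ?_⟩
    rw [hg, ih.2, hg', Finset.sum_range_succ, Finset.sum_range_succ, Nat.choose_succ_succ (n + 1),
      Nat.choose_one_right]
    push_cast
    ring

theorem quadratic_coeffs_eq {e₀ e₁ e₂ E A B : ℤ} {M : ℕ}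
    (h : ∀ n ≥ M, e₀ * (n + 2).choose 2 - e₁ * (n + 1 : ℕ) + e₂ =
      E * (n + 2).choose 2 - (n + 1 : ℕ) * A + B) : e₀ = E ∧ e₁ = A ∧ e₂ = B := by
  have h0 := h M le_rfl
  have h1 := h (M + 1) (by omega)
  have h2 := h (M + 2) (by omega)
  rw [Nat.choose_succ_succ (M + 1 + 1) 1, Nat.choose_one_right] at h1
  rw [Nat.choose_succ_succ (M + 2 + 1) 1, Nat.choose_succ_succ (M + 2) 1, Nat.choose_one_right,
    Nat.choose_one_right] at h2
  push_cast at h0 h1 h2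
  have ha : e₀ = E := by linear_combination h2 - 2 * h1 + h0
  subst ha
  have hb : e₁ = A := by linear_combination h0 - h1
  subst hb
  exact ⟨rfl, rfl, by linear_combination h0⟩

variable {R : Type u} [CommRing R] {I J : Ideal R} {e : ℕ → ℤ} {x y : R}

/-- The union over `k` of the colon ideals `I ^ (n + k) : x ^ k`. -/
def stableColon (I : Ideal R) (x : R) (hx : x ∈ I) (n : ℕ) : Ideal R where
  carrier := {z | ∃ k, x ^ k * z ∈ I ^ (n + k)}
  add_mem' := by
    have key : ∀ {k m z}, x ^ k * z ∈ I ^ (n + k) → x ^ (k + m) * z ∈ I ^ (n + (k + m)) := by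
      intro k m z hz
      have := Ideal.mul_mem_mul hz (Ideal.pow_mem_pow hx m)
      rw [← pow_add, add_assoc] at this
      convert this using 1
      ring
    rintro a b ⟨k, hk⟩ ⟨m, hm⟩
    refine ⟨k + m, ?_⟩
    rw [mul_add]
    refine Ideal.add_mem _ (key hk) ?_
    rw [add_comm k m]
    exact key hm
  zero_mem' := ⟨0, by simp⟩
  smul_mem' := by
    rintro c z ⟨k, hk⟩
    refine ⟨k, ?_⟩
    rw [smul_eq_mul, mul_left_comm]
    exact Ideal.mul_mem_left _ _ hk

theorem pow_le_stableColon (hx : x ∈ I) (n : ℕ) : I ^ n ≤ stableColon I x hx n :=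
  fun z hz => ⟨0, by simpa using hz⟩

theorem mul_mem_stableColon_succ_iff (hx : x ∈ I) (n : ℕ) (z : R) :
    x * z ∈ stableColon I x hx (n + 1) ↔ z ∈ stableColon I x hx n := by
  constructor
  · rintro ⟨k, hk⟩
    refine ⟨k + 1, ?_⟩
    rwa [pow_succ, mul_assoc, add_left_comm, add_comm k]
  · rintro ⟨k, hk⟩
    refine ⟨k, ?_⟩
    rw [mul_left_comm, add_right_comm, pow_succ']
    exact Ideal.mul_mem_mul hx hk

theorem mul_stableColon_le (hx : x ∈ I) (n : ℕ) :
    I * stableColon I x hx n ≤ stableColon I x hx (n + 1) := by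
  refine Ideal.mul_le.2 ?_
  rintro a ha z ⟨k, hk⟩
  refine ⟨k, ?_⟩
  rw [mul_left_comm, add_right_comm, pow_succ']
  exact Ideal.mul_mem_mul ha hk

theorem stableColon_zero (hx : x ∈ I) : stableColon I x hx 0 = ⊤ :=
  eq_top_iff.2 ((pow_le_stableColon hx 0).trans' (by simp))

theorem stableColon_eq_pow_of_ge (hx : x ∈ I) {N : ℕ}
    (hN : ∀ n ≥ N, ∀ z, x * z ∈ I ^ (n + 1) → z ∈ I ^ n) {n : ℕ} (hn : N ≤ n) :
    stableColon I x hx n = I ^ n := by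
  refine le_antisymm ?_ (pow_le_stableColon hx n)
  rintro z ⟨k, hk⟩
  induction k with
  | zero => simpa using hk
  | succ k ih => exact ih (hN (n + k) (by omega) _ (by rwa [← mul_assoc, ← pow_succ']))

theorem colength_span_singleton_mul_sup {F : Ideal R} (hy : RegularMod (Ideal.span {x}) y)
    (hf : FiniteColength (Ideal.span {y} * F ⊔ Ideal.span {x})) :
    colength (Ideal.span {y} * F ⊔ Ideal.span {x}) =
      colength (F ⊔ Ideal.span {x}) + colength (Ideal.span {x} ⊔ Ideal.span {y}) := by
  rw [hf.colength_eq_add (x := y) (L := F ⊔ Ideal.span {x})]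
  · congr 2
    rw [sup_assoc, sup_eq_right]
    exact Ideal.mul_le_left.trans le_sup_right
  · intro z
    rw [mem_sup_span_singleton_s2, mem_sup_span_singleton_s2]
    constructor
    · rintro ⟨w, hw⟩
      refine ⟨y * w, Ideal.mem_span_singleton_mul.2 ⟨_, hw, by ring⟩⟩
    · rintro ⟨w, hw⟩
      obtain ⟨f, hf, hfw⟩ := Ideal.mem_span_singleton_mul.1 hw
      have h1 : y * (z - f) ∈ Ideal.span {x} := by
        have : y * (z - f) = x * w := by linear_combination -hfw
        rw [this]
        exact Ideal.mul_mem_right _ _ (Ideal.mem_span_singleton_self x)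
      obtain ⟨u, hu⟩ := Ideal.mem_span_singleton'.1 (hy _ h1)
      refine ⟨u, ?_⟩
      have : z - x * u = f := by linear_combination -hu
      rwa [this]

theorem span_mul_sup_span (F : Ideal R) :
    (Ideal.span {x} ⊔ Ideal.span {y}) * F ⊔ Ideal.span {x} =
      Ideal.span {y} * F ⊔ Ideal.span {x} := by
  rw [Ideal.sup_mul, sup_comm (Ideal.span {x} * F), sup_assoc,
    sup_eq_right.2 (Ideal.mul_le_left : Ideal.span {x} * F ≤ Ideal.span {x})]

theorem eq_of_sup_span_le {F G : Ideal R} (hFG : G ≤ F)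
    (hcol : ∀ z, x * z ∈ F → x * z ∈ G) (h : F ≤ G ⊔ Ideal.span {x}) : F = G := by
  refine le_antisymm (fun z hz => ?_) hFG
  obtain ⟨w, hw⟩ := mem_sup_span_singleton_s2.1 (h hz)
  have h1 : x * w ∈ F := by
    have := F.sub_mem hz (hFG hw)
    rwa [sub_sub_cancel] at this
  have := G.add_mem hw (hcol w h1)
  rwa [sub_add_cancel] at this

theorem HasHilbertCoeffs.pow_three_eq_of_dim_two (h : HasHilbertCoeffs I 2 e)
    (h1 : e 0 - e 1 = colength I - 1) (h2 : e 2 ≠ 0) (hxI : x ∈ I) (hyI : y ∈ I)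
    (hy : RegularMod (Ideal.span {x}) y) (hx : EventuallyColonEq I x)
    (hJ : ∃ N, ∀ n ≥ N, I ^ (n + 1) = (Ideal.span {x} ⊔ Ideal.span {y}) * I ^ n) :
    I ^ 2 ≠ (Ideal.span {x} ⊔ Ideal.span {y}) * I ∧
      I ^ 3 = (Ideal.span {x} ⊔ Ideal.span {y}) * I ^ 2 ∧
      ∀ n z, x * z ∈ I ^ (n + 1) → z ∈ I ^ n := by
  obtain ⟨N₁, hN₁⟩ := hasHilbertCoeffs_iff.1 h
  obtain ⟨N₂, hN₂⟩ := hx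
  obtain ⟨N₃, hN₃⟩ := hJ
  set J : Ideal R := Ideal.span {x} ⊔ Ideal.span {y} with hJdef
  have hxJ : x ∈ J := Ideal.mem_sup_left (Ideal.mem_span_singleton_self x)
  have hJI : J ≤ I := by
    rw [hJdef, sup_le_iff, Ideal.span_singleton_le_iff_mem, Ideal.span_singleton_le_iff_mem]
    exact ⟨hxI, hyI⟩
  set F : ℕ → Ideal R := stableColon I x hxI
  have hIF : ∀ n, I ^ n ≤ F n := pow_le_stableColon hxI
  have hxF : ∀ n z, x * z ∈ F (n + 1) ↔ z ∈ F n := mul_mem_stableColon_succ_iff hxI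
  have hF0 : F 0 = ⊤ := stableColon_zero hxI
  have hFlarge : ∀ n ≥ N₂, F n = I ^ n := fun n hn => stableColon_eq_pow_of_ge hxI hN₂ hn
  have hJF : ∀ n, J * F n ≤ F (n + 1) := fun n =>
    (Ideal.mul_mono_left hJI).trans (mul_stableColon_le hxI n)
  have hIfin : ∀ n, FiniteColength (I ^ n) := h.finiteColength_pow
  have hFfin : ∀ n, FiniteColength (F n) := fun n => (hIfin n).mono (hIF n)
  have hKfin : ∀ n {L}, I ^ n ≤ L → FiniteColength (Ideal.span {y} * L ⊔ Ideal.span {x}) := by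
    intro n L hL
    rw [← span_mul_sup_span, ← hJdef]
    refine ((hIfin (max n N₃ + 1)).mono ?_).mono le_sup_left
    rw [hN₃ _ (le_max_right _ _)]
    exact Ideal.mul_mono_right ((Ideal.pow_le_pow_right (le_max_left _ _)).trans hL)
  have hK : ∀ n {L}, I ^ n ≤ L → colength (J * L ⊔ Ideal.span {x}) =
      colength (L ⊔ Ideal.span {x}) + colength J := fun n L hL => by
    rw [hJdef, span_mul_sup_span]
    exact colength_span_singleton_mul_sup hy (hKfin n hL)
  have hK' : ∀ n {L}, I ^ n ≤ L → FiniteColength (J * L ⊔ Ideal.span {x}) := fun n L hL => by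
    rw [hJdef, span_mul_sup_span]
    exact hKfin n hL
  let g : ℕ → ℤ := fun n => colength (F n ⊔ Ideal.span {x})
  let ρ : ℕ → ℤ := fun n => colength J + g n - g (n + 1)
  have hρ : ∀ n, 0 ≤ ρ n := fun n => by
    have h3 := (hK' n (hIF n)).colength_le (sup_le_sup_right (hJF n) (Ideal.span {x}))
    rw [hK n (hIF n)] at h3
    simp only [ρ, g]
    omega
  have hρ0 : ∀ n, ρ n = 0 → F (n + 1) = J * F n := fun n h0 => by
    have h3 := (hK' n (hIF n)).eq_of_colength_le (sup_le_sup_right (hJF n) (Ideal.span {x})) (by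
      rw [hK n (hIF n)]
      simp only [ρ, g] at h0
      omega)
    refine eq_of_sup_span_le (hJF n) (fun z hz => ?_) (le_sup_left.trans h3.ge)
    exact Ideal.mul_mem_mul hxJ ((hxF n z).1 hz)
  have hρlarge : ∀ n ≥ max N₂ N₃, ρ n = 0 := fun n hn => by
    have e1 := hFlarge n (le_of_max_le_left hn)
    have e2 := hFlarge (n + 1) ((le_of_max_le_left hn).trans (Nat.le_succ n))
    simp only [ρ, g]
    rw [e2, hN₃ n (le_of_max_le_right hn), hK n le_rfl, e1]
    push_cast
    ring
  have hsucc : ∀ n, (colength (F (n + 1)) : ℤ) = colength (F n) + g (n + 1) := fun n => by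
    rw [(hFfin (n + 1)).colength_eq_add (x := x) (L := F n) fun z => (hxF n z).symm]
    push_cast
    rfl
  have hform := sum_defect_formula (E := colength J) (h := fun n => (colength (F n) : ℤ)) (g := g)
    (by simp [hF0, colength_top]) (by simp [g, hF0, colength_top]) hsucc
  set k := max N₂ N₃
  set M := k + 2 with hM
  have hstab : ∀ (f : ℕ → ℤ) n, M ≤ n → ∑ i ∈ Finset.range n, f i * ρ i =
      ∑ i ∈ Finset.range M, f i * ρ i := fun f n hn => by
    refine (Finset.sum_subset (Finset.range_mono hn) fun i _ hi => ?_).symm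
    rw [Finset.mem_range, not_lt] at hi
    rw [hρlarge i (by omega), mul_zero]
  have hstab1 : ∀ n, M ≤ n → ∑ i ∈ Finset.range n, ρ i = ∑ i ∈ Finset.range M, ρ i :=
    fun n hn => by simpa using hstab 1 n hn
  obtain ⟨hE, hA, hB⟩ := quadratic_coeffs_eq (e₀ := e 0) (e₁ := e 1) (e₂ := e 2)
    (E := colength J) (A := ∑ i ∈ Finset.range M, ρ i) (B := ∑ i ∈ Finset.range M, i * ρ i)
    (M := max M N₁) (fun n hn => by
      have h3 := (hform (n + 1)).2
      have h4 := (hN₁ n (by omega)).2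
      rw [hFlarge (n + 1) (by omega), h4] at h3
      have h5 := hstab1 (n + 1) (by omega)
      have h6 := hstab (fun i => i) (n + 1) (by omega)
      simp only [ρ] at h5 h6 ⊢
      rw [← h5, ← h6, ← h3, Finset.sum_range_succ, Finset.sum_range_succ, Finset.sum_range_one]
      simp
      ring)
  have hF1 : colength (F 1) ≤ colength I := by
    have := (hIfin 1).colength_le (hIF 1)
    rwa [pow_one] at this
  have hρ_zero : ρ 0 = colength J - colength (F 1) := by
    have := hsucc 0
    simp only [ρ]
    simp only [zero_add, hF0, colength_top, g, top_sup_eq, Nat.cast_zero] at this ⊢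
    linarith
  have hA' : e 1 = ∑ i ∈ Finset.range k, ρ (i + 2) + ρ 1 + ρ 0 := by
    rw [hA, hM, Finset.sum_range_succ', Finset.sum_range_succ']
  have hTnonneg : 0 ≤ ∑ i ∈ Finset.range k, ρ (i + 2) :=
    Finset.sum_nonneg fun i _ => hρ (i + 2)
  have hρ_two : ∑ i ∈ Finset.range k, ρ (i + 2) = 0 → ∀ n ≥ 2, ρ n = 0 := fun hT n hn => by
    obtain ⟨i, rfl⟩ := Nat.exists_eq_add_of_le' hn
    by_cases hi : i < k
    · exact (Finset.sum_eq_zero_iff_of_nonneg fun i _ => hρ (i + 2)).1 hT i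
        (Finset.mem_range.2 hi)
    · exact hρlarge _ (by omega)
  have hρ1 := hρ 1
  have hF1I : F 1 = I := by
    by_contra hne
    have hlt : colength (F 1) < colength I := by
      by_contra hle
      have := (hIfin 1).eq_of_colength_le (hIF 1) (by rw [pow_one]; omega)
      rw [pow_one] at this
      exact hne this.symm
    refine h2 (hB.trans (Finset.sum_eq_zero fun i _ => ?_))
    rcases Nat.lt_or_ge i 2 with hi | hi
    · interval_cases i
      · simp
      · rw [show ρ 1 = 0 by omega, mul_zero]
    · rw [hρ_two (by omega) i hi, mul_zero]
  have hsum1 : ∑ i ∈ Finset.range k, ρ (i + 2) + ρ 1 = 1 := by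
    rw [hF1I] at hρ_zero
    omega
  have hne : I ^ 2 ≠ J * I := by
    intro hI2
    have hG : ∀ n, colength (I ^ (n + 1) ⊔ Ideal.span {x}) = n * colength J + colength I := by
      intro n
      induction n with
      | zero => simp [sup_eq_left.2 ((Ideal.span_singleton_le_iff_mem _).2 hxI)]
      | succ n ih =>
        have hstep : I ^ (n + 1 + 1) = J * I ^ (n + 1) := by
          rw [add_assoc, pow_add, one_add_one_eq_two, hI2, pow_succ]
          ring
        rw [hstep, hK _ le_rfl, ih]
        ring
    have h3 := (hform (k + 1 + 1)).1
    simp only [g] at h3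
    rw [hFlarge (k + 1 + 1) (by omega), hG] at h3
    change _ = _ - ∑ i ∈ Finset.range M, ρ i at h3
    rw [← hA] at h3
    push_cast at h3
    linarith
  have hxI2 : ∀ z, x * z ∈ F 2 → x * z ∈ J * I := fun z hz =>
    Ideal.mul_mem_mul hxJ (hF1I ▸ (hxF 1 z).1 hz)
  have hJI2 : J * I ≤ I ^ 2 := by
    rw [pow_two]
    exact Ideal.mul_mono_left hJI
  have hρ1' : ρ 1 ≠ 0 := fun h0 => by
    have := hρ0 1 h0
    rw [hF1I] at this
    exact hne (le_antisymm ((hIF 2).trans this.le) hJI2)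
  have hT : ∑ i ∈ Finset.range k, ρ (i + 2) = 0 := by omega
  have hF2 : F 2 = I ^ 2 := by
    refine eq_of_sup_span_le (hIF 2) (fun z hz => hJI2 (hxI2 z hz)) ?_
    have hI1 : I ^ 1 ≤ I := (pow_one I).le
    have hlt : colength (I ^ 2 ⊔ Ideal.span {x}) < colength (J * I ⊔ Ideal.span {x}) := by
      by_contra hle
      have h3 := (hK' 1 hI1).eq_of_colength_le (sup_le_sup_right hJI2 (Ideal.span {x}))
        (not_lt.1 hle)
      exact hne (eq_of_sup_span_le hJI2 (fun z hz => hxI2 z (hIF 2 hz))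
        (le_sup_left.trans h3.ge))
    rw [hK 1 hI1] at hlt
    have h3 : ρ 1 = 1 := by omega
    simp only [ρ, g, hF1I] at h3
    have h4 := ((hIfin 2).mono le_sup_left).eq_of_colength_le
      (sup_le_sup_right (hIF 2) (Ideal.span {x})) (by
        have e2 : F (1 + 1) = F 2 := rfl
        rw [e2] at h3
        omega)
    exact le_sup_left.trans h4.ge
  have hFI : ∀ n, F n = I ^ n := by
    have hFI2 : ∀ n ≥ 2, F n = I ^ n := by
      intro n hn
      induction n, hn using Nat.le_induction with
      | base => exact hF2
      | succ n hn ih =>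
        refine le_antisymm ?_ (hIF _)
        rw [hρ0 n (hρ_two hT n hn), ih, pow_succ']
        exact Ideal.mul_mono_left hJI
    intro n
    rcases Nat.lt_or_ge n 2 with hn | hn
    · interval_cases n
      · rw [hF0, pow_zero, Ideal.one_eq_top]
      · rw [hF1I, pow_one]
    · exact hFI2 n hn
  refine ⟨hne, ?_, fun n z hz => ?_⟩
  · have := hρ0 2 (hρ_two hT 2 le_rfl)
    rwa [hFI, hFI] at this
  · rw [← hFI] at hz ⊢
    exact (hxF n z).1 hz

end DimensionTwo

section Induction

variable {R : Type u} [CommRing R] {I J : Ideal R} {e : ℕ → ℤ}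

/-- Sally's descent: a degree one nonzerodivisor on the associated graded ring of `I` modulo a
superficial element `x` forces `x` to be a nonzerodivisor on the associated graded ring of `I`. -/
theorem colon_eq_pow_of_quotient {x y : R} (hxI : x ∈ I) (hyI : y ∈ I)
    (hx : EventuallyColonEq I x)
    (hy : ∀ n z, Ideal.Quotient.mk (Ideal.span {x}) y * z ∈
      (I.map (Ideal.Quotient.mk (Ideal.span {x}))) ^ (n + 1) →
      z ∈ (I.map (Ideal.Quotient.mk (Ideal.span {x}))) ^ n) (n : ℕ) (z : R)
    (hz : x * z ∈ I ^ (n + 1)) : z ∈ I ^ n := by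
  obtain ⟨N, hN⟩ := hx
  have hy' : ∀ p n z, Ideal.Quotient.mk (Ideal.span {x}) y ^ p * z ∈
      (I.map (Ideal.Quotient.mk (Ideal.span {x}))) ^ (n + p) →
      z ∈ (I.map (Ideal.Quotient.mk (Ideal.span {x}))) ^ n := fun p n => by
    induction p with
    | zero => simp
    | succ p ih =>
      intro z hz
      refine ih z (hy (n + p) _ ?_)
      rwa [← mul_assoc, ← pow_succ', add_assoc]
  have key : ∀ n z, (∃ p₀, ∀ p ≥ p₀, y ^ p * z ∈ I ^ (n + p)) → z ∈ I ^ n := by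
    intro n
    induction n with
    | zero => simp
    | succ n ih =>
      rintro z ⟨p₀, hp₀⟩
      have h1 : Ideal.Quotient.mk (Ideal.span {x}) z ∈
          (I.map (Ideal.Quotient.mk (Ideal.span {x}))) ^ (n + 1) := by
        refine hy' p₀ (n + 1) _ ?_
        rw [← Ideal.map_pow, ← map_pow, ← map_mul]
        exact Ideal.mem_map_of_mem _ (hp₀ p₀ le_rfl)
      rw [← Ideal.map_pow, ← Ideal.mem_comap, comap_map_mk_span_singleton] at h1
      obtain ⟨a, ha⟩ := mem_sup_span_singleton_s2.1 h1
      have ha' : a ∈ I ^ n := ih a ⟨max p₀ N, fun p hp => hN (n + p) (by omega) _ (by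
        have h2 := Ideal.mul_mem_mul ha (Ideal.pow_mem_pow hyI p)
        rw [← pow_add] at h2
        have h3 := Ideal.sub_mem _ (hp₀ p (le_of_max_le_left hp)) h2
        convert h3 using 1
        · rw [add_right_comm]
        · ring)⟩
      have h2 := Ideal.mul_mem_mul hxI ha'
      rw [← pow_succ'] at h2
      have := Ideal.add_mem _ ha h2
      rwa [sub_add_cancel] at this
  refine key n z ⟨N, fun p hp => hN (n + p) (by omega) _ ?_⟩
  have h2 := Ideal.mul_mem_mul hz (Ideal.pow_mem_pow hyI p)
  rw [← pow_add] at h2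
  convert h2 using 1
  · rw [add_right_comm]
  · ring

theorem SuperficialReduction.pow_three_eq_of_two_le {d : ℕ}
    (hJ : SuperficialReduction (d + 2) R I J) (h : HasHilbertCoeffs I (d + 2) e)
    (h1 : e 0 - e 1 = colength I - 1) (h2 : e 2 ≠ 0) :
    I ^ 2 ≠ J * I ∧ I ^ 3 = J * I ^ 2 ∧ ∃ x ∈ I, ∀ n z, x * z ∈ I ^ (n + 1) → z ∈ I ^ n := by
  induction d generalizing R with
  | zero =>
    have hred := hJ.exists_pow_succ_eq
    obtain ⟨x, hxJ, hxI, -, hx, y', hyJ, hyI, hy, -, hJy, -⟩ := hJ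
    obtain ⟨y, rfl⟩ := Ideal.Quotient.mk_surjective y'
    rw [← Ideal.mem_comap, comap_map_mk_of_mem hxI] at hyI
    have hJ : J = Ideal.span {x} ⊔ Ideal.span {y} := by
      have h3 := comap_map_mk_of_mem hyJ
      rw [hJy, ← RingHom.ker_eq_comap_bot, Ideal.mk_ker] at h3
      rw [← comap_map_mk_of_mem hxJ, ← h3, ← Set.image_singleton, ← Ideal.map_span,
        comap_map_mk_span_singleton, sup_comm]
    have hy' : RegularMod (Ideal.span {x}) y := fun z hz => by
      rw [← Ideal.Quotient.eq_zero_iff_mem] at hz ⊢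
      rw [map_mul] at hz
      exact hy _ hz
    rw [hJ] at hred ⊢
    obtain ⟨h3, h4, h5⟩ := h.pow_three_eq_of_dim_two h1 h2 hxI hyI hy' hx hred
    exact ⟨h3, h4, x, hxI, h5⟩
  | succ d ih =>
    have hJI := hJ.le
    obtain ⟨x, hxJ, hxI, -, hx, hJ⟩ := hJ
    obtain ⟨h3, h4, y', hyI, hy⟩ := ih hJ (h.map hxI hx)
      (by rw [← colength_comap_mk, comap_map_mk_of_mem hxI]; exact h1)
    obtain ⟨y, rfl⟩ := Ideal.Quotient.mk_surjective y'
    rw [← Ideal.mem_comap, comap_map_mk_of_mem hxI] at hyI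
    have hcol := colon_eq_pow_of_quotient hxI hyI hx hy
    refine ⟨fun heq => h3 ?_, pow_succ_le_mul_pow_of_map hJI hxJ (hcol 2) h4, x, hxI, hcol⟩
    rw [← Ideal.map_pow, heq, Ideal.map_mul]

theorem SuperficialReduction.pow_three_eq {d : ℕ} (hd : 0 < d)
    (hJ : SuperficialReduction d R I J) (h : HasHilbertCoeffs I d e)
    (h1 : e 0 - e 1 = colength I - 1) (h2 : e 2 ≠ 0) : I ^ 2 ≠ J * I ∧ I ^ 3 = J * I ^ 2 := by
  match d, hd with
  | 1, _ => exact hJ.pow_three_eq_of_dim_one h h1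
  | d + 2, _ =>
    obtain ⟨h3, h4, -⟩ := hJ.pow_three_eq_of_two_le h h1 h2
    exact ⟨h3, h4⟩

theorem isReductionNumberRel_two (h2 : I ^ 2 ≠ J * I) (h3 : I ^ 3 = J * I ^ 2) :
    IsReductionNumberRel J I 2 := by
  refine ⟨h3, fun k (hk : I ^ (k + 1) = J * I ^ k) => ?_⟩
  by_contra hlt
  have hk2 : k < 2 := not_le.1 hlt
  interval_cases k
  · rw [zero_add, pow_one, pow_zero, mul_one] at hk
    exact h2 (by rw [← hk, pow_two])
  · rw [pow_one] at hk
    exact h2 hk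

end Induction

/-- **Vasconcelos (1994), Theorem 3.6**.  Let `(R,m)` be a Cohen-Macaulay Noetherian local
ring of dimension `d > 0` with infinite residue field and `I` an `m`-primary ideal.  If
`e₀(I) - e₁(I) = λ(R/I) - 1` and `e₂(I) ≠ 0`, then `I` has reduction number `2`. -/
theorem reduction_number_eq_two
    {R : Type*} [CommRing R] [IsNoetherianRing R] [IsLocalRing R]
    (d : ℕ) (hd : 0 < d) (hdim : ringKrullDim R = d)
    (hCM : IsCohenMacaulayLocalRing R)
    (hres : Infinite (IsLocalRing.ResidueField R))
    (I : Ideal R) (hI : I.radical = maximalIdeal R)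
    (e : ℕ → ℤ) (he : HasHilbertCoeffs I d e)
    (lI : ℕ) (hlI : moduleLength R (R ⧸ I) = (lI : WithBot ℕ∞))
    (h1 : e 0 - e 1 = (lI : ℤ) - 1) (h2 : e 2 ≠ 0) :
    IsReductionNumber I 2 := by
  obtain ⟨hfin, rfl⟩ := moduleLength_eq_natCast_iff.1 hlI
  obtain ⟨rs, hrs, hreg, hlen⟩ := hCM
  obtain rfl : rs.length = d := by exact_mod_cast hlen.trans hdim
  have hdepth := DepthGE.of_isWeaklyRegular rs hrs hreg.toIsWeaklyRegular
  have hIm : I ≤ maximalIdeal R := hI ▸ Ideal.le_radical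
  obtain ⟨k, hk⟩ := Ideal.exists_radical_pow_le_of_fg I (IsNoetherian.noetherian _)
  rw [hI] at hk
  have hex : ∀ J, IsReduction J I → ∃ J' ≤ J, SuperficialReduction rs.length R I J' :=
    fun J hJ => hJ.exists_superficialReduction hdim.le hdepth hIm hk
  obtain ⟨J, -, hJ⟩ := hex I ⟨le_rfl, 0, by simp⟩
  refine ⟨⟨J, ⟨hJ.isReduction, fun J₁ hJ₁ hred => ?_⟩, ?_⟩, ?_⟩
  · obtain ⟨J₂, hJ₂, hJ₂'⟩ := hex J₁ hred
    obtain ⟨hf, hc⟩ := hJ₂'.colength_eq he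
    have := hf.eq_of_colength_le (hJ₂.trans hJ₁) (by
      have := (hJ.colength_eq he).2
      omega)
    exact le_antisymm hJ₁ (this ▸ hJ₂)
  · obtain ⟨h3, h4⟩ := hJ.pow_three_eq hd he h1 h2
    exact isReductionNumberRel_two h3 h4
  · rintro k ⟨J₁, ⟨hred, hmin⟩, hJ₁⟩
    obtain ⟨J₂, hJ₂, hJ₂'⟩ := hex J₁ hred
    obtain rfl := hmin J₂ hJ₂ hJ₂'.isReduction
    obtain ⟨h3, h4⟩ := hJ₂'.pow_three_eq hd he h1 h2
    exact ((isReductionNumberRel_two h3 h4).unique hJ₁).le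
end

section
/- Let (R,m) be a Noetherian local ring of dimension d ≥ 1, let I be an m-primary ideal, and let J ⊆ I be an ideal generated by a system of parameters of R. Then for every n ≥ 0, λ(I^n/I^{n+1}) ≤ λ(R/I)·C(n+d−1,d−1) + λ(I/J)·C(n+d−2,d−1), where C denotes the binomial coefficient (with C(d−2,d−1) = 0 when n = 0). -/
open Finset IsLocalRing

theorem coe_module_length_eq_moduleLength (R M : Type*) [CommRing R] [AddCommGroup M]
    [Module R M] : (Module.length R M : WithBot ℕ∞) = moduleLength R M :=
  Module.coe_length R M

/-- Length is subadditive along sequences exact in the middle. -/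
theorem Module.length_le_add_of_exact {R M N P : Type*} [Ring R] [AddCommGroup M] [Module R M]
    [AddCommGroup N] [Module R N] [AddCommGroup P] [Module R P]
    (f : M →ₗ[R] N) (g : N →ₗ[R] P) (h : Function.Exact f g) :
    Module.length R N ≤ Module.length R M + Module.length R P := by
  rw [Module.length_eq_add_of_exact g.ker.subtype g.rangeRestrict
    (Submodule.subtype_injective _) g.surjective_rangeRestrict
    (by rw [LinearMap.exact_iff, LinearMap.ker_rangeRestrict, Submodule.range_subtype])]
  rw [h.linearMap_ker_eq]
  exact add_le_add (Module.length_le_of_surjective _ f.surjective_rangeRestrict)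
    (Module.length_le_of_injective _ (Submodule.subtype_injective _))

theorem Submodule.length_quotient_eq_add {R M : Type*} [Ring R] [AddCommGroup M] [Module R M]
    {A B : Submodule R M} (h : A ≤ B) :
    Module.length R (M ⧸ A) =
      Module.length R (↥B ⧸ A.comap B.subtype) + Module.length R (M ⧸ B) := by
  refine Module.length_eq_add_of_exact (Submodule.mapQ _ A B.subtype le_rfl)
    (Submodule.factor h) ?_ (Submodule.factor_surjective h) ?_
  · rw [← LinearMap.ker_eq_bot, Submodule.ker_mapQ, Submodule.mkQ_map_self]
  · rw [LinearMap.exact_iff, Submodule.range_mapQ, Submodule.range_subtype, Submodule.factor,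
      Submodule.ker_mapQ, Submodule.comap_id]

theorem Submodule.length_quotient_anti {R M : Type*} [Ring R] [AddCommGroup M] [Module R M]
    {A B : Submodule R M} (h : A ≤ B) : Module.length R (M ⧸ B) ≤ Module.length R (M ⧸ A) :=
  Module.length_le_of_surjective _ (Submodule.factor_surjective h)

/-- Multiplication by `x` gives an exact sequence `R ⧸ A → R ⧸ B → R ⧸ (B + xR) → 0`. -/
theorem Ideal.length_quotient_le_add {R : Type*} [CommRing R] {A B : Ideal R} {x : R}
    (h : ∀ a ∈ A, x * a ∈ B) :
    Module.length R (R ⧸ B) ≤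
      Module.length R (R ⧸ A) + Module.length R (R ⧸ (B ⊔ Ideal.span {x})) := by
  have h' : A ≤ Submodule.comap (LinearMap.mulLeft R x) B := h
  refine Module.length_le_add_of_exact
    (Submodule.mapQ A B (LinearMap.mulLeft R x) h')
    (Submodule.factor (le_sup_left : B ≤ B ⊔ Ideal.span {x})) ?_
  have hx : LinearMap.range (LinearMap.mulLeft R x) = Ideal.span {x} := by
    ext y
    simp [Ideal.mem_span_singleton, dvd_def, eq_comm]
  rw [LinearMap.exact_iff, Submodule.range_mapQ, hx, Submodule.factor, Submodule.ker_mapQ,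
    Submodule.comap_id, Submodule.map_sup, Submodule.mkQ_map_self, bot_sup_eq]

theorem Ideal.length_quotient_pow_succ_sup_le {R : Type*} [CommRing R] {I : Ideal R}
    (K : Ideal R) {x : R} (hx : x ∈ I) (n : ℕ) :
    Module.length R (R ⧸ (I ^ (n + 1) ⊔ K)) ≤ Module.length R (R ⧸ (I ^ n ⊔ K)) +
      Module.length R (R ⧸ (I ^ (n + 1) ⊔ (K ⊔ Ideal.span {x}))) := by
  rw [← sup_assoc]
  refine Ideal.length_quotient_le_add fun a ha ↦ ?_
  obtain ⟨y, hy, z, hz, rfl⟩ := Submodule.mem_sup.mp ha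
  rw [mul_add, pow_succ']
  exact Submodule.add_mem_sup (Ideal.mul_mem_mul hx hy) (K.mul_mem_left x hz)

/-- If `J ≤ I` is generated modulo `K` by `d` elements, then the length of
`R ⧸ (I ^ (n + 1) + K)` is bounded by a polynomial in `n` of degree `d`. -/
theorem Ideal.length_quotient_pow_succ_sup_le_choose {R : Type*} [CommRing R] {I J : Ideal R}
    (hJI : J ≤ I) {a b : ℕ} (ha : Module.length R (R ⧸ I) = a)
    (hb : Module.length R (↥I ⧸ Submodule.comap (I : Ideal R).subtype J) = b)
    (d : ℕ) (x : Fin d → R) (K : Ideal R) (hK : K ⊔ Ideal.span (Set.range x) = J) (n : ℕ) :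
    Module.length R (R ⧸ (I ^ (n + 1) ⊔ K)) ≤
      ((a * (n + d).choose d + b * (if n = 0 then 0 else (n - 1 + d).choose d) : ℕ) : ℕ∞) := by
  induction d generalizing K n with
  | zero =>
    obtain rfl : K = J := by simpa using hK
    cases n with
    | zero =>
      have hI : I ≤ I ^ (0 + 1) ⊔ K := by simp
      simpa [ha] using Submodule.length_quotient_anti hI
    | succ n =>
      refine (Submodule.length_quotient_anti (le_sup_right : K ≤ I ^ (n + 1 + 1) ⊔ K)).trans ?_
      rw [Submodule.length_quotient_eq_add hJI]
      simp [ha, hb, add_comm]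
  | succ d ih =>
    induction n with
    | zero =>
      have hI : I ≤ I ^ (0 + 1) ⊔ K := by simp
      simpa [ha] using Submodule.length_quotient_anti hI
    | succ n ihn =>
      have hx : x 0 ∈ I := hJI (hK ▸ Ideal.mem_sup_right (Ideal.subset_span ⟨0, rfl⟩))
      have hK' : K ⊔ Ideal.span {x 0} ⊔ Ideal.span (Set.range (Fin.tail x)) = J := by
        rw [← hK, sup_assoc, ← Ideal.span_union, ← Set.insert_eq, ← Fin.range_cons,
          Fin.cons_self_tail]
      refine (Ideal.length_quotient_pow_succ_sup_le K hx (n + 1)).trans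
        ((add_le_add ihn (ih _ _ hK' (n + 1))).trans ?_)
      norm_cast
      have h₁ : (n + 1 + (d + 1)).choose (d + 1) =
          (n + 1 + d).choose d + (n + (d + 1)).choose (d + 1) := by
        rw [← add_assoc, Nat.choose_succ_succ, add_right_comm n 1 d, add_assoc n d 1]
      have h₂ : (n + (d + 1)).choose (d + 1) = (n + d).choose d +
          (if n = 0 then 0 else (n - 1 + (d + 1)).choose (d + 1)) := by
        rw [← add_assoc, Nat.choose_succ_succ]
        cases n with
        | zero => simp
        | succ n => simp [add_right_comm n 1 d, add_assoc]
      simp only [if_false, Nat.add_sub_cancel]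
      rw [h₁]
      nth_rewrite 3 [h₂]
      apply le_of_eq
      ring

/-- **Rossi–Valla–Vasconcelos (2001), Theorem 2.2**.  Let `(R,m)` be a Noetherian local ring
of dimension `d ≥ 1`, `I` an `m`-primary ideal and `J ⊆ I` an ideal generated by a system
of parameters of `R`.  Then for every `n ≥ 0`,
`λ(Iⁿ/Iⁿ⁺¹) ≤ λ(R/I)·C(n+d-1,d-1) + λ(I/J)·C(n+d-2,d-1)`,
where the last binomial coefficient is interpreted as `0` when `n = 0`. -/
theorem hilbert_function_le_of_system_of_parameters
    {R : Type*} [CommRing R] [IsNoetherianRing R] [IsLocalRing R]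
    (d : ℕ) (hd : 1 ≤ d) (hdim : ringKrullDim R = d)
    (I J : Ideal R) (hI : I.radical = maximalIdeal R) (hJI : J ≤ I)
    (hsop : ∃ x : Fin d → R, (∀ i, x i ∈ maximalIdeal R) ∧
      J = Ideal.span (Set.range x) ∧ J.radical = maximalIdeal R)
    (lI lIJ : ℕ)
    (hlI : moduleLength R (R ⧸ I) = (lI : WithBot ℕ∞))
    (hlIJ : moduleLength R (↥I ⧸ Submodule.comap (I : Ideal R).subtype J) =
      (lIJ : WithBot ℕ∞)) :
    ∀ n : ℕ,
      moduleLength R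
        (↥(I ^ n) ⧸ Submodule.comap (I ^ n : Ideal R).subtype (I ^ (n + 1))) ≤
      ((lI * ((n + d - 1).choose (d - 1)) +
        lIJ * (if n = 0 then 0 else (n + d - 2).choose (d - 1)) : ℕ) : WithBot ℕ∞) := by
  intro n
  obtain ⟨d, rfl⟩ := Nat.exists_eq_add_of_le' hd
  obtain ⟨x, -, hJ, -⟩ := hsop
  rw [← coe_module_length_eq_moduleLength] at hlI hlIJ ⊢
  have ha : Module.length R (R ⧸ I) = lI := by exact_mod_cast hlI
  have hb : Module.length R (↥I ⧸ Submodule.comap (I : Ideal R).subtype J) = lIJ := by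
    exact_mod_cast hlIJ
  have hx : x 0 ∈ I := hJI (hJ ▸ Ideal.subset_span ⟨0, rfl⟩)
  have hfin : Module.length R (R ⧸ I ^ n) ≠ ⊤ := by
    have h := Ideal.length_quotient_pow_succ_sup_le_choose hJI ha hb _ x ⊥
      (by rw [bot_sup_eq, hJ]) n
    rw [sup_bot_eq] at h
    exact ne_top_of_le_ne_top (ENat.natCast_ne_top _)
      ((Submodule.length_quotient_anti (Ideal.pow_le_pow_right n.le_succ)).trans h)
  have hstep := Ideal.length_quotient_pow_succ_sup_le (⊥ : Ideal R) hx n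
  rw [sup_bot_eq, sup_bot_eq, bot_sup_eq,
    Submodule.length_quotient_eq_add (Ideal.pow_le_pow_right n.le_succ : I ^ (n + 1) ≤ I ^ n),
    add_comm, ENat.add_le_add_iff_left hfin] at hstep
  have hbound := Ideal.length_quotient_pow_succ_sup_le_choose hJI ha hb d (Fin.tail x)
    (Ideal.span {x 0}) (by
      rw [hJ, ← Ideal.span_union, ← Set.insert_eq, ← Fin.range_cons, Fin.cons_self_tail]) n
  have h := WithBot.coe_le_coe.mpr (hstep.trans hbound)
  cases n with
  | zero => simpa using h
  | succ n =>
    have e : n + 1 + (d + 1) - 2 = n + d := by omega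
    have e' : n + 1 + (d + 1) - 1 = n + 1 + d := by omega
    simpa [e, e'] using h
end
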